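/- arXiv:1708.00413 — 3 statements merged into one kernel-verified Lean document; each statement's English description precedes it below -/
import Mathlib

section
/- Let k ≥ 2 be an integer and let P ⊂ ℝ^d be a lattice polytope of dimension d that is not a simplex, with δ-polynomial δ(P,t) = 1 + t + 2t^k, such that ℤ((P,1) ∩ ℤ^{d+1}) ≠ ℤ^{d+1} and P is not a lattice pyramid. Then d = 2k and P is unimodularly equivalent to B^(4) = conv{0, e_1, …, e_{d−1}, Σ_{j=1}^{d−2} e_j + 2e_d, −e_1 + e_{d−1}} ⊂ ℝ^d. -/
open Pointwise Polynomial

noncomputable section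

/-- The set of lattice points of `ℝ^d` (points with integer coordinates). -/
def latticePts (d : ℕ) : Set (Fin d → ℝ) := {x | ∀ i, ∃ z : ℤ, x i = (z : ℝ)}

/-- A lattice polytope: the convex hull of finitely many lattice points. -/
def IsLatticePolytope {d : ℕ} (P : Set (Fin d → ℝ)) : Prop :=
  ∃ V : Finset (Fin d → ℝ), (V : Set (Fin d → ℝ)) ⊆ latticePts d ∧
    P = convexHull ℝ (V : Set (Fin d → ℝ))

/-- `|nP ∩ ℤ^d|`. -/
def ehrhartCount {d : ℕ} (P : Set (Fin d → ℝ)) (n : ℕ) : ℕ :=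
  (latticePts d ∩ (n : ℝ) • P).ncard

/-- The Ehrhart series `1 + Σ_{n ≥ 1} |nP ∩ ℤ^d| tⁿ`. -/
def ehrhartSeries {d : ℕ} (P : Set (Fin d → ℝ)) : PowerSeries ℤ :=
  PowerSeries.mk fun n => if n = 0 then 1 else (ehrhartCount P n : ℤ)

/-- `p` is the δ-polynomial of the lattice polytope `P ⊆ ℝ^d` of dimension `d`,
i.e. `(1 - t)^(d+1) (1 + Σ_{n ≥ 1} |nP ∩ ℤ^d| tⁿ) = p`. -/
def HasDeltaPoly {d : ℕ} (P : Set (Fin d → ℝ)) (p : Polynomial ℤ) : Prop :=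
  (1 - PowerSeries.X) ^ (d + 1) * ehrhartSeries P = (p : PowerSeries ℤ)

/-- Unimodular equivalence: an affine map carrying `ℤ^d ∩ aff P` bijectively onto
`ℤ^e ∩ aff Q` and mapping `P` onto `Q`. -/
def UnimodEquiv {d e : ℕ} (P : Set (Fin d → ℝ)) (Q : Set (Fin e → ℝ)) : Prop :=
  ∃ f : (Fin d → ℝ) →ᵃ[ℝ] (Fin e → ℝ),
    Set.BijOn f (latticePts d ∩ (affineSpan ℝ P : Set (Fin d → ℝ)))
      (latticePts e ∩ (affineSpan ℝ Q : Set (Fin e → ℝ))) ∧ f '' P = Q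

/-- The lattice pyramid `Pyr(Q) = conv(Q × {0}, (0,…,0,1)) ⊆ ℝ^{e+1}`. -/
def pyramidOver {e : ℕ} (Q : Set (Fin e → ℝ)) : Set (Fin (e + 1) → ℝ) :=
  convexHull ℝ
    ((fun x : Fin e → ℝ => Fin.snoc x (0 : ℝ)) '' Q ∪ {Fin.snoc (0 : Fin e → ℝ) (1 : ℝ)})

/-- `P` is a lattice pyramid over some (full-dimensional) lattice polytope. -/
def IsLatticePyramid {d : ℕ} (P : Set (Fin d → ℝ)) : Prop :=
  ∃ (e : ℕ) (Q : Set (Fin e → ℝ)), IsLatticePolytope Q ∧ affineSpan ℝ Q = ⊤ ∧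
    UnimodEquiv P (pyramidOver Q)

/-- `P ⊆ ℝ^d` is a simplex (of some dimension). -/
def IsSimplex {d : ℕ} (P : Set (Fin d → ℝ)) : Prop :=
  ∃ (n : ℕ) (v : Fin (n + 1) → Fin d → ℝ), AffineIndependent ℝ v ∧
    P = convexHull ℝ (Set.range v)

/-- A full-dimensional lattice simplex of dimension `d` in `ℝ^d`. -/
def IsLatticeSimplexFD {d : ℕ} (Δ : Set (Fin d → ℝ)) : Prop :=
  ∃ v : Fin (d + 1) → Fin d → ℝ, AffineIndependent ℝ v ∧
    (∀ i, v i ∈ latticePts d) ∧ Δ = convexHull ℝ (Set.range v)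

/-- `ℤ((P,1) ∩ ℤ^{d+1}) = ℤ^{d+1}`: the lattice points of `P`, with last coordinate `1`
appended, generate all of `ℤ^{d+1}` as a group. -/
def SpansLattice {d : ℕ} (P : Set (Fin d → ℝ)) : Prop :=
  AddSubgroup.closure {y : Fin (d + 1) → ℤ |
    y (Fin.last d) = 1 ∧ (fun i : Fin d => (y i.castSucc : ℝ)) ∈ P} = ⊤

/-- The finite abelian group `Λ_Δ ⊆ (ℝ/ℤ)^{d+1}` attached to a lattice simplex with
ordered vertices `v 0, …, v d`, encoded by its canonical representatives in `[0,1)`. -/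
def simplexLambda {d : ℕ} (v : Fin (d + 1) → Fin d → ℝ) : Set (Fin (d + 1) → ℝ) :=
  {c | (∀ i, 0 ≤ c i ∧ c i < 1) ∧
    (∀ j : Fin d, ∃ z : ℤ, (∑ i, c i * v i j) = (z : ℝ)) ∧
    (∃ z : ℤ, (∑ i, c i) = (z : ℝ))}

/-- The standard basis vector `e_j` of `ℝ^d` (0-indexed). -/
def stdE (d : ℕ) (j : Fin d) : Fin d → ℝ := fun i => if i = j then 1 else 0

/-- `A⁽⁴⁾₁ = conv{0, e₁, …, e_{d−1}, Σ_{j=1}^{d−2} e_j + 2e_d, e₁ − e_{d−1}} ⊆ ℝ^d`. -/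
def polyA41 (d : ℕ) : Set (Fin d → ℝ) :=
  convexHull ℝ
    ({0,
      fun j : Fin d => if (j : ℕ) = d - 1 then (2 : ℝ) else if (j : ℕ) + 2 < d then 1 else 0,
      fun j : Fin d => if (j : ℕ) = 0 then (1 : ℝ) else if (j : ℕ) = d - 2 then -1 else 0} ∪
      {x | ∃ j : Fin d, (j : ℕ) < d - 1 ∧ x = stdE d j})

/-- `A⁽⁴⁾₂ = conv{0, e₁, …, e_{d−1}, Σ_{j=1}^{d−3} e_j + 2e_d, e_{d−2} + e_{d−1}} ⊆ ℝ^d`. -/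
def polyA42 (d : ℕ) : Set (Fin d → ℝ) :=
  convexHull ℝ
    ({0,
      fun j : Fin d => if (j : ℕ) = d - 1 then (2 : ℝ) else if (j : ℕ) + 3 < d then 1 else 0,
      fun j : Fin d => if (j : ℕ) = d - 3 ∨ (j : ℕ) = d - 2 then (1 : ℝ) else 0} ∪
      {x | ∃ j : Fin d, (j : ℕ) < d - 1 ∧ x = stdE d j})

/-- `A⁽⁴⁾₃ = conv{0, e₁, …, e_{d−1}, Σ_{j=1}^{d−4} e_j + 2e_d, −e_{d−3} + e_{d−2} + e_{d−1}} ⊆ ℝ^d`. -/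
def polyA43 (d : ℕ) : Set (Fin d → ℝ) :=
  convexHull ℝ
    ({0,
      fun j : Fin d => if (j : ℕ) = d - 1 then (2 : ℝ) else if (j : ℕ) + 4 < d then 1 else 0,
      fun j : Fin d =>
        if (j : ℕ) = d - 4 then (-1 : ℝ)
        else if (j : ℕ) = d - 3 ∨ (j : ℕ) = d - 2 then 1 else 0} ∪
      {x | ∃ j : Fin d, (j : ℕ) < d - 1 ∧ x = stdE d j})

/-- `B⁽⁴⁾ = conv{0, e₁, …, e_{d−1}, Σ_{j=1}^{d−2} e_j + 2e_d, −e₁ + e_{d−1}} ⊆ ℝ^d`. -/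
def polyB4 (d : ℕ) : Set (Fin d → ℝ) :=
  convexHull ℝ
    ({0,
      fun j : Fin d => if (j : ℕ) = d - 1 then (2 : ℝ) else if (j : ℕ) + 2 < d then 1 else 0,
      fun j : Fin d => if (j : ℕ) = 0 then (-1 : ℝ) else if (j : ℕ) = d - 2 then 1 else 0} ∪
      {x | ∃ j : Fin d, (j : ℕ) < d - 1 ∧ x = stdE d j})

/-- The tuples in `ℕ^ι` of total `n` having a zero at some place of `Z`. -/
def tuplesVanishing {ι : Type*} [Fintype ι] [DecidableEq ι] (Z : Finset ι) (n : ℕ) :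
    Finset (ι →₀ ℕ) :=
  (Finset.finsuppAntidiag Finset.univ n).filter fun m => ∃ i ∈ Z, m i = 0

lemma mem_tuplesVanishing {ι : Type*} [Fintype ι] [DecidableEq ι] {Z : Finset ι} {n : ℕ}
    {m : ι →₀ ℕ} : m ∈ tuplesVanishing Z n ↔ ∑ i, m i = n ∧ ∃ i ∈ Z, m i = 0 := by
  simp [tuplesVanishing]

lemma tuplesVanishing_series {ι : Type*} [Fintype ι] [DecidableEq ι] (Z : Finset ι) :
    (1 - PowerSeries.X : PowerSeries ℤ) ^ Fintype.card ι *
      PowerSeries.mk (fun n => ((tuplesVanishing Z n).card : ℤ)) =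
      1 - PowerSeries.X ^ Z.card := by
  classical
  set G : PowerSeries ℤ := PowerSeries.mk 1 with hG
  have hG1 : G * (1 - PowerSeries.X) = 1 := PowerSeries.mk_one_mul_one_sub_eq_one ℤ
  have hmk : PowerSeries.mk (fun n => ((tuplesVanishing Z n).card : ℤ)) =
      (∏ _i : ι, G) - ∏ i : ι, if i ∈ Z then PowerSeries.X * G else G := by
    ext n
    rw [map_sub, PowerSeries.coeff_prod, PowerSeries.coeff_prod, PowerSeries.coeff_mk,
      ← Finset.sum_sub_distrib, tuplesVanishing, Finset.card_filter, Nat.cast_sum]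
    refine Finset.sum_congr rfl fun m _ => ?_
    have h1 : ∏ i : ι, PowerSeries.coeff (m i) G = 1 :=
      Finset.prod_eq_one fun i _ => by simp [hG]
    have h2 : ∀ i, PowerSeries.coeff (m i) (if i ∈ Z then PowerSeries.X * G else G) =
        if i ∈ Z ∧ m i = 0 then 0 else 1 := by
      intro i
      by_cases hi : i ∈ Z
      · rcases Nat.eq_zero_or_pos (m i) with h0 | h0
        · simp [hi, h0]
        · obtain ⟨a, ha⟩ := Nat.exists_eq_succ_of_ne_zero h0.ne'
          rw [if_pos hi, ha, mul_comm, Nat.succ_eq_add_one, PowerSeries.coeff_succ_mul_X]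
          simp [hG]
      · simp [hi, hG]
    rw [h1, Finset.prod_congr rfl fun i _ => h2 i]
    by_cases h : ∃ i ∈ Z, m i = 0
    · obtain ⟨i, hi, hm⟩ := h
      rw [Finset.prod_eq_zero (Finset.mem_univ i) (by simp [hi, hm]), if_pos ⟨i, hi, hm⟩]
      simp
    · rw [if_neg h, Finset.prod_eq_one]
      · simp
      · intro i _
        rw [if_neg]
        exact fun hh => h ⟨i, hh⟩
  have hprod : (∏ i : ι, if i ∈ Z then PowerSeries.X * G else G) =
      PowerSeries.X ^ Z.card * G ^ Fintype.card ι := by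
    have : ∀ i : ι, (if i ∈ Z then PowerSeries.X * G else G) =
        (if i ∈ Z then PowerSeries.X else 1) * G := by
      intro i; split_ifs <;> simp
    rw [Finset.prod_congr rfl fun i _ => this i, Finset.prod_mul_distrib]
    simp
  rw [hmk, hprod, Finset.prod_const, Finset.card_univ, mul_sub, mul_left_comm, ← mul_pow,
    mul_comm (1 - PowerSeries.X), hG1]
  simp

lemma weighted_sum_series {α : Type*} (Γ : Finset α) (h z : α → ℕ) (p : Polynomial ℤ)
    (hsum : ∑ g ∈ Γ, (PowerSeries.X : PowerSeries ℤ) ^ h g * (1 - PowerSeries.X ^ z g) =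
      (1 - PowerSeries.X) * (p : PowerSeries ℤ)) :
    ∑ g ∈ Γ, (X : Polynomial ℤ) ^ h g * ∑ j ∈ Finset.range (z g), X ^ j = p := by
  apply Polynomial.coe_injective ℤ
  have h1 : (1 - PowerSeries.X : PowerSeries ℤ) ≠ 0 := by
    intro h0
    have := congrArg (PowerSeries.coeff 0) h0
    simp at this
  apply mul_left_cancel₀ h1
  rw [← hsum, ← Polynomial.coeToPowerSeries.ringHom_apply, map_sum, Finset.mul_sum]
  refine Finset.sum_congr rfl fun g _ => ?_
  have := mul_neg_geom_sum (PowerSeries.X : PowerSeries ℤ) (z g)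
  simp only [map_mul, map_pow, map_sum, Polynomial.coeToPowerSeries.ringHom_apply,
    Polynomial.coe_X]
  rw [← this]
  ring

lemma weighted_sum_total {α : Type*} (Γ : Finset α) (h z : α → ℕ) (k : ℕ)
    (hsum : ∑ g ∈ Γ, (X : Polynomial ℤ) ^ h g * ∑ j ∈ Finset.range (z g), X ^ j =
      1 + X + Polynomial.C 2 * X ^ k) : ∑ g ∈ Γ, z g = 4 := by
  have := congrArg (Polynomial.eval 1) hsum
  simp [Polynomial.eval_finsetSum] at this
  have h2 : ((∑ g ∈ Γ, z g : ℕ) : ℤ) = 4 := by push_cast; rw [this]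
  exact_mod_cast h2

lemma weighted_sum_heights {α : Type*} [DecidableEq α] (Γ : Finset α) (h z : α → ℕ) (k : ℕ)
    (o : α) (ho : o ∈ Γ) (hh : h o = 0) (hz : z o = 2)
    (hpos : ∀ g ∈ Γ, 0 < z g)
    (hsum : ∑ g ∈ Γ, (X : Polynomial ℤ) ^ h g * ∑ j ∈ Finset.range (z g), X ^ j =
      1 + X + Polynomial.C 2 * X ^ k) :
    ∀ g ∈ Γ, g ≠ o → h g = k ∧ z g = 1 := by
  intro g hg hgo
  rw [← Finset.add_sum_erase Γ _ ho, hh, hz] at hsum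
  have hsum' : ∑ g ∈ Γ.erase o, (X : Polynomial ℤ) ^ h g * ∑ j ∈ Finset.range (z g), X ^ j =
      Polynomial.C 2 * X ^ k := by
    have h2 : ∑ j ∈ Finset.range 2, (X : Polynomial ℤ) ^ j = 1 + X := by
      simp [Finset.sum_range_succ]
    rw [h2, pow_zero, one_mul] at hsum
    exact add_left_cancel hsum
  have hcoe : ∀ (g : α) (n : ℕ), Polynomial.coeff ((X : Polynomial ℤ) ^ h g *
      ∑ j ∈ Finset.range (z g), X ^ j) n = if h g ≤ n ∧ n - h g < z g then 1 else 0 := by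
    intro g n
    rw [mul_comm, Polynomial.coeff_mul_X_pow']
    by_cases hn : h g ≤ n
    · simp [hn, Polynomial.finsetSum_coeff, Polynomial.coeff_X_pow]
    · simp [hn]
  have key : ∀ n, h g ≤ n → n - h g < z g → n = k := by
    intro n h1 h2
    by_contra hne
    have hc := congrArg (fun q => Polynomial.coeff q n) hsum'
    simp only [Polynomial.finsetSum_coeff, hcoe, Polynomial.coeff_C_mul,
      Polynomial.coeff_X_pow, if_neg hne, mul_zero] at hc
    have hnn := (Finset.sum_eq_zero_iff_of_nonneg (fun i _ => by split_ifs <;> simp)).1 hc g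
      (Finset.mem_erase.2 ⟨hgo, hg⟩)
    simp [h1, h2] at hnn
  have hp := hpos g hg
  have e1 := key (h g) le_rfl (by omega)
  refine ⟨e1, ?_⟩
  by_contra hz1
  have e2 := key (h g + 1) (by omega) (by omega)
  omega

/-- The lattice `ℤ^d` as a subgroup of `ℝ^d`. -/
def latticeSubgroup (d : ℕ) : AddSubgroup (Fin d → ℝ) where
  carrier := latticePts d
  zero_mem' := fun _ => ⟨0, by simp⟩
  add_mem' := fun {a b} ha hb i => by
    obtain ⟨x, hx⟩ := ha i
    obtain ⟨y, hy⟩ := hb i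
    exact ⟨x + y, by simp [hx, hy]⟩
  neg_mem' := fun {a} ha i => by
    obtain ⟨x, hx⟩ := ha i
    exact ⟨-x, by simp [hx]⟩

lemma mem_latticeSubgroup {d : ℕ} {x : Fin d → ℝ} : x ∈ latticeSubgroup d ↔ x ∈ latticePts d :=
  Iff.rfl

/-- The coefficient vectors whose combination of the lifted points `(v i, 1)` is a lattice
point of `ℝ^{d+1}`. -/
def coeffLattice {d : ℕ} {ι : Type*} [Fintype ι] (v : ι → Fin d → ℝ) : AddSubgroup (ι → ℝ) where
  carrier := {c | (∃ z : ℤ, ∑ i, c i = z) ∧ ∑ i, c i • v i ∈ latticeSubgroup d}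
  zero_mem' := ⟨⟨0, by simp⟩, by simp [zero_mem]⟩
  add_mem' := fun {a b} ⟨⟨x, hx⟩, ha⟩ ⟨⟨y, hy⟩, hb⟩ =>
    ⟨⟨x + y, by simp [Finset.sum_add_distrib, hx, hy]⟩, by
      simpa only [Pi.add_apply, add_smul, Finset.sum_add_distrib] using add_mem ha hb⟩
  neg_mem' := fun {a} ⟨⟨x, hx⟩, ha⟩ =>
    ⟨⟨-x, by simp [hx]⟩, by
      simpa only [Pi.neg_apply, neg_smul, Finset.sum_neg_distrib] using neg_mem ha⟩

lemma int_mem_coeffLattice {d : ℕ} {ι : Type*} [Fintype ι] {v : ι → Fin d → ℝ}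
    (hv : ∀ i, v i ∈ latticePts d) (m : ι → ℤ) : (fun i => (m i : ℝ)) ∈ coeffLattice v := by
  refine ⟨⟨∑ i, m i, by push_cast; rfl⟩, sum_mem fun i _ => ?_⟩
  rw [Int.cast_smul_eq_zsmul]
  exact zsmul_mem (mem_latticeSubgroup.2 (hv i)) (m i)

lemma fract_mem_coeffLattice {d : ℕ} {ι : Type*} [Fintype ι] {v : ι → Fin d → ℝ}
    (hv : ∀ i, v i ∈ latticePts d) {c : ι → ℝ} (hc : c ∈ coeffLattice v) :
    (fun i => Int.fract (c i)) ∈ coeffLattice v :=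
  sub_mem hc (int_mem_coeffLattice hv fun i => ⌊c i⌋)

/-- A spanning configuration of lattice points whose affine relations are the multiples of
`lam`. -/
structure IsCircuit {d : ℕ} {ι : Type*} [Fintype ι] (v : ι → Fin d → ℝ) (lam : ι → ℝ) : Prop where
  int : ∀ i, v i ∈ latticePts d
  ne_zero : lam ≠ 0
  sum_zero : ∑ i, lam i = 0
  comb_zero : ∑ i, lam i • v i = 0
  unique : ∀ μ : ι → ℝ, ∑ i, μ i = 0 → ∑ i, μ i • v i = 0 → ∃ t : ℝ, μ = t • lam
  span : ∀ (x : Fin d → ℝ) (t : ℝ), ∃ c : ι → ℝ, ∑ i, c i = t ∧ ∑ i, c i • v i = x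

namespace IsCircuit

variable {d : ℕ} {ι : Type*} [Fintype ι] {v : ι → Fin d → ℝ} {lam : ι → ℝ}

lemma smul (h : IsCircuit v lam) {a : ℝ} (ha : a ≠ 0) : IsCircuit v (a • lam) where
  int := h.int
  ne_zero := smul_ne_zero ha h.ne_zero
  sum_zero := by simp [← Finset.mul_sum, h.sum_zero]
  comb_zero := by simp [mul_smul, ← Finset.smul_sum, h.comb_zero]
  unique := fun μ h1 h2 => by
    obtain ⟨t, rfl⟩ := h.unique μ h1 h2
    exact ⟨t / a, by rw [smul_smul, div_mul_cancel₀ _ ha]⟩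
  span := h.span

lemma neg (h : IsCircuit v lam) : IsCircuit v (-lam) := by
  simpa using h.smul (a := -1) (by norm_num)

lemma exists_pos (h : IsCircuit v lam) : ∃ i, 0 < lam i := by
  by_contra! hn
  apply h.ne_zero
  ext i
  have := (Finset.sum_eq_zero_iff_of_nonpos fun i _ => hn i).1 h.sum_zero i (Finset.mem_univ i)
  simpa using this

lemma smul_mem (h : IsCircuit v lam) (t : ℝ) : t • lam ∈ coeffLattice v := by
  refine ⟨⟨0, by simp [← Finset.mul_sum, h.sum_zero]⟩, ?_⟩
  have : ∑ i, (t • lam) i • v i = 0 := by simp [mul_smul, ← Finset.smul_sum, h.comb_zero]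
  rw [this]
  exact zero_mem _

/-- Nonnegative coefficient vectors vanishing somewhere on the positive part of the circuit
are determined by the point they represent. -/
lemma eq_of_nonneg (h : IsCircuit v lam) {c c' : ι → ℝ} (hc : ∀ i, 0 ≤ c i)
    (hc' : ∀ i, 0 ≤ c' i) (hz : ∃ i, 0 < lam i ∧ c i = 0) (hz' : ∃ i, 0 < lam i ∧ c' i = 0)
    (hs : ∑ i, c i = ∑ i, c' i) (hv : ∑ i, c i • v i = ∑ i, c' i • v i) : c = c' := by
  obtain ⟨t, ht⟩ := h.unique (c - c') (by simp [hs]) (by simp [sub_smul, hv])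
  have hti : ∀ i, c i - c' i = t * lam i := fun i => by simpa using congrFun ht i
  obtain ⟨i, hi, h0⟩ := hz
  obtain ⟨i', hi', h0'⟩ := hz'
  have h1 := hti i
  have h2 := hti i'
  have h3 := hc' i
  have h4 := hc i'
  have h5 : t ≤ 0 := by
    by_contra! hpos
    nlinarith [mul_pos hpos hi]
  have h6 : 0 ≤ t := by
    by_contra! hneg
    nlinarith [mul_neg_of_neg_of_pos hneg hi']
  have h7 : t = 0 := le_antisymm h5 h6
  ext j
  have := hti j
  rw [h7] at this
  linarith

/-- A nonnegative combination can be moved along the circuit until a coefficient of its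
positive part vanishes. -/
lemma exists_nonneg_vanishing (h : IsCircuit v lam) {c : ι → ℝ} (hc : ∀ i, 0 ≤ c i) :
    ∃ c' : ι → ℝ, (∀ i, 0 ≤ c' i) ∧ (∃ i, 0 < lam i ∧ c' i = 0) ∧
      ∑ i, c' i = ∑ i, c i ∧ ∑ i, c' i • v i = ∑ i, c i • v i := by
  classical
  obtain ⟨i₁, hi₁⟩ := h.exists_pos
  obtain ⟨i, hi, hmin⟩ := Finset.exists_min_image (Finset.univ.filter fun i => 0 < lam i)
    (fun i => c i / lam i) ⟨i₁, by simpa using hi₁⟩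
  simp only [Finset.mem_filter, Finset.mem_univ, true_and] at hi hmin
  refine ⟨c - (c i / lam i) • lam, fun j => ?_, ⟨i, hi, ?_⟩, ?_, ?_⟩
  · simp only [Pi.sub_apply, Pi.smul_apply, smul_eq_mul, sub_nonneg]
    rcases lt_or_ge 0 (lam j) with hj | hj
    · exact (le_div_iff₀ hj).1 (hmin j hj)
    · exact (mul_nonpos_of_nonneg_of_nonpos (div_nonneg (hc i) hi.le) hj).trans (hc j)
  · simp [div_mul_cancel₀ _ hi.ne']
  · simp [← Finset.mul_sum, h.sum_zero]
  · simp [sub_smul, mul_smul, ← Finset.smul_sum, h.comb_zero]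

end IsCircuit

/-- The coefficient vectors in the half-open cube, giving lattice points, which vanish somewhere
on the positive part of `lam`. -/
def boxSet {d : ℕ} {ι : Type*} [Fintype ι] (v : ι → Fin d → ℝ) (lam : ι → ℝ) : Set (ι → ℝ) :=
  {g | (∀ i, 0 ≤ g i ∧ g i < 1) ∧ g ∈ coeffLattice v ∧ ∃ i, 0 < lam i ∧ g i = 0}

/-- The places on the positive part of `lam` where `g` vanishes. -/
def zeroPlaces {ι : Type*} [Fintype ι] (lam g : ι → ℝ) : Finset ι :=
  open Classical in Finset.univ.filter fun i => 0 < lam i ∧ g i = 0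

lemma mem_zeroPlaces {ι : Type*} [Fintype ι] {lam g : ι → ℝ} {i : ι} :
    i ∈ zeroPlaces lam g ↔ 0 < lam i ∧ g i = 0 := by
  simp [zeroPlaces]

/-- The height of a coefficient vector. -/
def coeffHeight {ι : Type*} [Fintype ι] (g : ι → ℝ) : ℕ := ⌊∑ i, g i⌋₊

namespace IsCircuit

variable {d : ℕ} {ι : Type*} [Fintype ι] {v : ι → Fin d → ℝ} {lam : ι → ℝ}

lemma coe_height {g : ι → ℝ} (hg : g ∈ boxSet v lam) : (coeffHeight g : ℝ) = ∑ i, g i := by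
  obtain ⟨h1, ⟨⟨z, hz⟩, _⟩, _⟩ := hg
  have h0 : 0 ≤ ∑ i, g i := Finset.sum_nonneg fun i _ => (h1 i).1
  rw [coeffHeight, hz] at *
  have : 0 ≤ z := by exact_mod_cast h0
  obtain ⟨n, rfl⟩ := Int.eq_ofNat_of_zero_le this
  simp

lemma zeroPlaces_pos {g : ι → ℝ} (hg : g ∈ boxSet v lam) : 0 < (zeroPlaces lam g).card := by
  obtain ⟨_, _, i, hi⟩ := hg
  exact Finset.card_pos.2 ⟨i, mem_zeroPlaces.2 hi⟩

lemma fract_mem_box (h : IsCircuit v lam) {c : ι → ℝ} (hc : c ∈ coeffLattice v) {i : ι}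
    (hi : 0 < lam i) (hz : c i = 0) : (fun i => Int.fract (c i)) ∈ boxSet v lam :=
  ⟨fun _ => ⟨Int.fract_nonneg _, Int.fract_lt_one _⟩, fract_mem_coeffLattice h.int hc,
    i, hi, by simp [hz]⟩

lemma zero_mem_box (h : IsCircuit v lam) : (0 : ι → ℝ) ∈ boxSet v lam := by
  obtain ⟨i, hi⟩ := h.exists_pos
  exact ⟨fun _ => by simp, zero_mem _, i, hi, rfl⟩

lemma finite_box (h : IsCircuit v lam) : (boxSet v lam).Finite := by
  classical
  have hfin : (Set.range fun y : (Fin d → ℤ) × ℤ => ((fun j => (y.1 j : ℝ)), (y.2 : ℝ))) ∩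
      {p : (Fin d → ℝ) × ℝ | (∀ j, |p.1 j| ≤ ∑ i, |v i j|) ∧ |p.2| ≤ Fintype.card ι} |>.Finite := by
    set N : ℤ := ⌈(Fintype.card ι : ℝ)⌉
    set B : Fin d → ℤ := fun j => ⌈∑ i, |v i j|⌉
    refine ((Set.finite_Icc ((-B, -N) : (Fin d → ℤ) × ℤ) (B, N)).image
      fun y : (Fin d → ℤ) × ℤ => ((fun j => (y.1 j : ℝ)), (y.2 : ℝ))).subset ?_
    rintro _ ⟨⟨y, rfl⟩, h1, h2⟩
    refine ⟨y, ?_, rfl⟩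
    have hb : ∀ j, |y.1 j| ≤ B j := fun j => by
      have : |(y.1 j : ℝ)| ≤ (B j : ℝ) := (h1 j).trans (Int.le_ceil _)
      exact_mod_cast this
    have hn : |y.2| ≤ N := by
      have : |(y.2 : ℝ)| ≤ (N : ℝ) := h2.trans (Int.le_ceil _)
      exact_mod_cast this
    exact ⟨⟨fun j => (abs_le.1 (hb j)).1, (abs_le.1 hn).1⟩,
      ⟨fun j => (abs_le.1 (hb j)).2, (abs_le.1 hn).2⟩⟩
  refine Set.Finite.of_finite_image (f := fun c => (∑ i, c i • v i, ∑ i, c i))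
    (hfin.subset ?_) ?_
  · rintro _ ⟨g, ⟨h1, ⟨⟨z, hz⟩, h2⟩, -⟩, rfl⟩
    choose y hy using h2
    refine ⟨⟨(y, z), by ext <;> simp [← hy, hz]⟩, fun j => ?_, ?_⟩
    · simp only [Finset.sum_apply, Pi.smul_apply, smul_eq_mul]
      refine (Finset.abs_sum_le_sum_abs _ _).trans (Finset.sum_le_sum fun i _ => ?_)
      rw [abs_mul, abs_of_nonneg (h1 i).1]
      exact mul_le_of_le_one_left (abs_nonneg _) (h1 i).2.le
    · refine (Finset.abs_sum_le_sum_abs _ _).trans ?_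
      rw [← Finset.card_univ, Finset.card_eq_sum_ones, Nat.cast_sum]
      refine Finset.sum_le_sum fun i _ => ?_
      rw [abs_of_nonneg (h1 i).1]
      simpa using (h1 i).2.le
  · intro g hg g' hg' he
    simp only [Prod.mk.injEq] at he
    exact h.eq_of_nonneg (fun i => (hg.1 i).1) (fun i => (hg'.1 i).1) hg.2.2 hg'.2.2 he.2 he.1

end IsCircuit

lemma smul_convexHull_range {d : ℕ} {ι : Type*} [Fintype ι] [Nonempty ι] (v : ι → Fin d → ℝ)
    (n : ℕ) (x : Fin d → ℝ) : x ∈ (n : ℝ) • convexHull ℝ (Set.range v) ↔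
      ∃ c : ι → ℝ, (∀ i, 0 ≤ c i) ∧ ∑ i, c i = n ∧ ∑ i, c i • v i = x := by
  classical
  rw [Set.mem_smul_set]
  constructor
  · rintro ⟨y, hy, rfl⟩
    rw [convexHull_range_eq_exists_affineCombination] at hy
    obtain ⟨s, w, h0, h1, rfl⟩ := hy
    refine ⟨fun i => if i ∈ s then n * w i else 0, fun i => ?_, ?_, ?_⟩
    · dsimp only
      split_ifs with hi
      · exact mul_nonneg n.cast_nonneg (h0 i hi)
      · exact le_rfl
    · simp [Finset.sum_ite_mem, ← Finset.mul_sum, h1]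
    · rw [Finset.affineCombination_eq_linear_combination _ _ _ h1, Finset.smul_sum]
      simp [ite_smul, Finset.sum_ite_mem, mul_smul]
  · rintro ⟨c, h0, h1, rfl⟩
    rcases Nat.eq_zero_or_pos n with rfl | hn
    · refine ⟨v (Classical.arbitrary ι), subset_convexHull ℝ _ ⟨_, rfl⟩, ?_⟩
      have : ∀ i, c i = 0 := fun i =>
        (Finset.sum_eq_zero_iff_of_nonneg fun i _ => h0 i).1 (by simpa using h1) i
          (Finset.mem_univ i)
      simp [this]
    · have hn' : (n : ℝ) ≠ 0 := by positivity
      refine ⟨∑ i, (c i / n) • v i, ?_, ?_⟩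
      · refine (convex_convexHull ℝ _).sum_mem (fun i _ => div_nonneg (h0 i) n.cast_nonneg) ?_
          fun i _ => subset_convexHull ℝ _ ⟨i, rfl⟩
        rw [← Finset.sum_div, h1, div_self hn']
      · rw [Finset.smul_sum]
        refine Finset.sum_congr rfl fun i _ => ?_
        rw [smul_smul, mul_div_cancel₀ _ hn']

namespace IsCircuit

variable {d : ℕ} {ι : Type*} [Fintype ι] [DecidableEq ι] {v : ι → Fin d → ℝ} {lam : ι → ℝ}

/-- The lattice points of the dilates are counted by the box points and tuples of naturals. -/
lemma ehrhartCount_eq [Nonempty ι] (h : IsCircuit v lam) (n : ℕ) :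
    ehrhartCount (convexHull ℝ (Set.range v)) n =
      ∑ g ∈ h.finite_box.toFinset, if coeffHeight g ≤ n then
        (tuplesVanishing (zeroPlaces lam g) (n - coeffHeight g)).card else 0 := by
  classical
  set T : Finset (Σ _ : ι → ℝ, ι →₀ ℕ) := h.finite_box.toFinset.sigma fun g =>
    if coeffHeight g ≤ n then tuplesVanishing (zeroPlaces lam g) (n - coeffHeight g) else ∅
    with hT
  have hTcard : T.card = ∑ g ∈ h.finite_box.toFinset, if coeffHeight g ≤ n then
        (tuplesVanishing (zeroPlaces lam g) (n - coeffHeight g)).card else 0 := by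
    rw [hT, Finset.card_sigma]
    exact Finset.sum_congr rfl fun g _ => by split_ifs <;> simp
  have hmem : ∀ g m, (⟨g, m⟩ : Σ _ : ι → ℝ, ι →₀ ℕ) ∈ T ↔ g ∈ boxSet v lam ∧
      ∑ i, (g i + m i) = n ∧ ∃ i, 0 < lam i ∧ g i = 0 ∧ m i = 0 := by
    intro g m
    rw [hT, Finset.mem_sigma, Set.Finite.mem_toFinset]
    dsimp only
    refine and_congr_right fun hg => ?_
    have hh := coe_height hg
    rw [Finset.sum_add_distrib, ← hh]
    split_ifs with hle
    · simp only [mem_tuplesVanishing, mem_zeroPlaces, and_assoc]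
      refine and_congr_left fun _ => ?_
      rw [← Nat.cast_sum, ← Nat.cast_add, Nat.cast_inj]
      omega
    · simp only [Finset.notMem_empty, false_iff, not_and]
      intro hs
      rw [← Nat.cast_sum, ← Nat.cast_add, Nat.cast_inj] at hs
      omega
  rw [← hTcard, ehrhartCount, ← Set.ncard_coe_finset]
  symm
  refine Set.ncard_congr (fun p _ => ∑ i, (p.1 i + p.2 i) • v i) ?_ ?_ ?_
  · rintro ⟨g, m⟩ hp
    obtain ⟨hg, hs, i, hi, h0, h1⟩ := (hmem g m).1 hp
    refine ⟨?_, (smul_convexHull_range v n _).2 ⟨_, fun i => ?_, hs, rfl⟩⟩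
    · have := (add_mem hg.2.1 (int_mem_coeffLattice h.int fun i => (m i : ℤ))).2
      simpa [mem_latticeSubgroup] using this
    · exact add_nonneg (hg.1 i).1 (Nat.cast_nonneg _)
  · rintro ⟨g, m⟩ ⟨g', m'⟩ hp hp' he
    obtain ⟨hg, hs, i, hi, h0, h1⟩ := (hmem g m).1 hp
    obtain ⟨hg', hs', i', hi', h0', h1'⟩ := (hmem g' m').1 hp'
    have hc := h.eq_of_nonneg (c := fun i => g i + m i) (c' := fun i => g' i + m' i)
      (fun i => add_nonneg (hg.1 i).1 (Nat.cast_nonneg _))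
      (fun i => add_nonneg (hg'.1 i).1 (Nat.cast_nonneg _)) ⟨i, hi, by simp [h0, h1]⟩
      ⟨i', hi', by simp [h0', h1']⟩ (hs.trans hs'.symm) he
    have hgg : g = g' := by
      ext j
      have := congrArg Int.fract (congrFun hc j)
      simpa [Int.fract_eq_self.2 (hg.1 j), Int.fract_eq_self.2 (hg'.1 j)] using this
    subst hgg
    have hmm : m = m' := by
      ext j
      have := congrFun hc j
      simpa using this
    rw [hmm]
  · rintro x ⟨hx, hxP⟩
    obtain ⟨c₀, hc₀, hs₀, hv₀⟩ := (smul_convexHull_range v n x).1 hxP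
    obtain ⟨c, hc, ⟨i, hi, hz⟩, hs, hv⟩ := h.exists_nonneg_vanishing hc₀
    have hcΛ : c ∈ coeffLattice v := ⟨⟨n, by rw [hs, hs₀]; simp⟩, by rw [hv, hv₀]; exact hx⟩
    have hsum : ∀ j, Int.fract (c j) + ((⌊c j⌋.toNat : ℕ) : ℝ) = c j := by
      intro j
      have h1 : ((⌊c j⌋.toNat : ℕ) : ℝ) = ((⌊c j⌋.toNat : ℤ) : ℝ) := (Int.cast_natCast _).symm
      rw [h1, Int.toNat_of_nonneg (Int.floor_nonneg.2 (hc j)), Int.fract_add_floor]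
    refine ⟨⟨fun j => Int.fract (c j), Finsupp.equivFunOnFinite.symm fun j => ⌊c j⌋.toNat⟩,
      (hmem _ _).2 ⟨h.fract_mem_box hcΛ hi hz, ?_, i, hi, by simp [hz], by simp [hz]⟩, ?_⟩
    · simp [hsum, hs, hs₀]
    · simp [hsum, hv, hv₀]

lemma ehrhartSeries_eq [Nonempty ι] (h : IsCircuit v lam) :
    ehrhartSeries (convexHull ℝ (Set.range v)) =
      ∑ g ∈ h.finite_box.toFinset, PowerSeries.X ^ coeffHeight g *
        PowerSeries.mk fun n => ((tuplesVanishing (zeroPlaces lam g) n).card : ℤ) := by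
  ext n
  have hcount : PowerSeries.coeff n (ehrhartSeries (convexHull ℝ (Set.range v))) =
      (ehrhartCount (convexHull ℝ (Set.range v)) n : ℤ) := by
    rw [ehrhartSeries, PowerSeries.coeff_mk]
    split_ifs with hn
    · subst hn
      have hne : (convexHull ℝ (Set.range v)).Nonempty := (Set.range_nonempty v).convexHull
      have : latticePts d ∩ ((0 : ℕ) : ℝ) • convexHull ℝ (Set.range v) = {0} := by
        rw [Nat.cast_zero, Set.zero_smul_set hne]
        exact Set.inter_eq_right.2 (by
          rintro _ rfl
          exact (latticeSubgroup d).zero_mem)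
      rw [ehrhartCount, this, Set.ncard_singleton, Nat.cast_one]
    · rfl
  rw [hcount, h.ehrhartCount_eq, map_sum, Nat.cast_sum]
  refine Finset.sum_congr rfl fun g _ => ?_
  rw [PowerSeries.coeff_X_pow_mul']
  split_ifs <;> simp

lemma box_sum_eq [Nonempty ι] (h : IsCircuit v lam) (hcard : Fintype.card ι = d + 2)
    {p : Polynomial ℤ} (hp : HasDeltaPoly (convexHull ℝ (Set.range v)) p) :
    ∑ g ∈ h.finite_box.toFinset, (X : Polynomial ℤ) ^ coeffHeight g *
      ∑ j ∈ Finset.range (zeroPlaces lam g).card, X ^ j = p := by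
  apply weighted_sum_series
  rw [← hp, ← mul_assoc, ← pow_succ', h.ehrhartSeries_eq, Finset.mul_sum, ← hcard]
  refine Finset.sum_congr rfl fun g _ => ?_
  rw [mul_left_comm, tuplesVanishing_series]

end IsCircuit

/-- The integral tuples in `ℝ^ι`. -/
def intTuples (ι : Type*) : AddSubgroup (ι → ℝ) :=
  ((Int.castRingHom ℝ).toAddMonoidHom.compLeft ι).range

lemma mem_intTuples {ι : Type*} {c : ι → ℝ} : c ∈ intTuples ι ↔ ∀ i, ∃ z : ℤ, c i = z := by
  constructor
  · rintro ⟨m, rfl⟩ i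
    exact ⟨m i, rfl⟩
  · intro h
    choose m hm using h
    exact ⟨m, funext fun i => (hm i).symm⟩

lemma sub_fract_mem_intTuples {ι : Type*} (c : ι → ℝ) :
    c - (fun i => Int.fract (c i)) ∈ intTuples ι :=
  mem_intTuples.2 fun i => ⟨⌊c i⌋, by simp⟩

lemma half_of_two_mul_int {x : ℝ} (h0 : 0 ≤ x) (h1 : x < 1) (h2 : ∃ z : ℤ, 2 * x = z) :
    x = 0 ∨ x = 1 / 2 := by
  obtain ⟨z, hz⟩ := h2
  have a : (-1 : ℝ) < z := by linarith
  have b : (z : ℝ) < 2 := by linarith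
  have a' : -1 < z := by exact_mod_cast a
  have b' : z < 2 := by exact_mod_cast b
  have : z = 0 ∨ z = 1 := by omega
  rcases this with rfl | rfl
  · left; simp at hz; exact hz
  · right; push_cast at hz; linarith

/-- If negative integers, at least two in number, sum to `-2`, then there are exactly two of
them, both equal to `-1`. -/
lemma neg_one_of_sum_eq_neg_two {ι : Type*} (J : Finset ι) (f : ι → ℝ)
    (hf : ∀ i ∈ J, ∃ z : ℤ, f i = z) (hneg : ∀ i ∈ J, f i < 0) (hJ : 2 ≤ J.card)
    (hs : ∑ i ∈ J, f i = -2) : J.card = 2 ∧ ∀ i ∈ J, f i = -1 := by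
  have hle : ∀ i ∈ J, 0 ≤ -f i - 1 := by
    intro i hi
    obtain ⟨z, hz⟩ := hf i hi
    have h1 := hneg i hi
    rw [hz] at h1 ⊢
    have h2 : z < 0 := by exact_mod_cast h1
    have h3 : z ≤ -1 := by omega
    have h4 : (z : ℝ) ≤ -1 := by exact_mod_cast h3
    linarith
  have hsum : ∑ i ∈ J, (-f i - 1) = 2 - J.card := by
    rw [Finset.sum_sub_distrib, Finset.sum_neg_distrib, hs]
    simp
  have h0 : (2 : ℝ) ≤ J.card := by exact_mod_cast hJ
  have h1 := Finset.sum_nonneg hle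
  have h2 : ∑ i ∈ J, (-f i - 1) = 0 := le_antisymm (by rw [hsum]; linarith) h1
  refine ⟨?_, fun i hi => ?_⟩
  · have : (J.card : ℝ) = 2 := by linarith
    exact_mod_cast this
  · have := (Finset.sum_eq_zero_iff_of_nonneg hle).1 h2 i hi
    linarith

namespace IsCircuit

variable {d : ℕ} {ι : Type*} [Fintype ι] {v : ι → Fin d → ℝ} {lam : ι → ℝ}

lemma fract_mem_box_of_fract (h : IsCircuit v lam) {c : ι → ℝ} (hc : c ∈ coeffLattice v) {i : ι}
    (hi : 0 < lam i) (hz : Int.fract (c i) = 0) : (fun i => Int.fract (c i)) ∈ boxSet v lam :=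
  ⟨fun _ => ⟨Int.fract_nonneg _, Int.fract_lt_one _⟩, fract_mem_coeffLattice h.int hc,
    i, hi, hz⟩

lemma sub_smul_mem (h : IsCircuit v lam) {c : ι → ℝ} (hc : c ∈ coeffLattice v) (t : ℝ) :
    c - t • lam ∈ coeffLattice v := sub_mem hc (h.smul_mem t)

/-- Box points with a prescribed zero in the class of a coefficient vector. -/
lemma exists_box_class (h : IsCircuit v lam) {c : ι → ℝ} (hc : c ∈ coeffLattice v) {i : ι}
    (hi : 0 < lam i) : ∃ g ∈ boxSet v lam, g i = 0 ∧ ∃ t : ℝ, c - t • lam - g ∈ intTuples ι := by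
  have h0 : (c - (c i / lam i) • lam) i = 0 := by simp [div_mul_cancel₀ _ hi.ne']
  exact ⟨_, h.fract_mem_box (h.sub_smul_mem hc (c i / lam i)) hi h0, by simp only [h0]; simp,
    c i / lam i, sub_fract_mem_intTuples _⟩

/-- Integrality of the normalised circuit and half-integrality of a box point. -/
lemma integrality (h : IsCircuit v lam) {c g g' : ι → ℝ} {i : ι} (hi : 0 < lam i)
    (hcn : ∀ t : ℝ, c - t • lam ∉ intTuples ι)
    (hbox : ∀ b ∈ boxSet v lam, b = 0 ∨ b = g ∨ b = g') (hg : g ∈ boxSet v lam)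
    (hgi : g i = 0) (hg' : g' i ≠ 0) (hclass : ∃ t : ℝ, c - t • lam - g ∈ intTuples ι) :
    (lam i)⁻¹ • lam ∈ intTuples ι ∧ (2 : ℝ) • g ∈ intTuples ι := by
  obtain ⟨t, ht⟩ := hclass
  have hgn : ∀ s : ℝ, s • lam - g ∉ intTuples ι := by
    intro s hs
    have := sub_mem ht hs
    refine hcn (t + s) ?_
    convert this using 1
    module
  constructor
  · set ρ := (lam i)⁻¹ • lam with hρ
    have hρi : Int.fract (ρ i) = 0 := by simp [hρ, inv_mul_cancel₀ hi.ne']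
    have hint := sub_fract_mem_intTuples ρ
    rcases hbox _ (h.fract_mem_box_of_fract (h.smul_mem _) hi hρi) with hb | hb | hb
    · rw [hb] at hint
      simpa using hint
    · rw [hb] at hint
      exact absurd hint (hgn _)
    · exact absurd ((congrFun hb i).symm.trans hρi) hg'
  · have hmem : (2 : ℝ) • g ∈ coeffLattice v := by
      rw [two_smul]
      exact add_mem hg.2.1 hg.2.1
    have hz : Int.fract (((2 : ℝ) • g) i) = 0 := by simp [hgi]
    have hint := sub_fract_mem_intTuples ((2 : ℝ) • g)
    rcases hbox _ (h.fract_mem_box_of_fract hmem hi hz) with hb | hb | hb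
    · rw [hb] at hint
      simpa using hint
    · rw [hb] at hint
      refine absurd (neg_mem hint) ?_
      convert hgn 0 using 2
      module
    · exact absurd ((congrFun hb i).symm.trans hz) hg'

variable [DecidableEq ι]

/-- For δ-polynomial `1 + t + 2t^k` and a nontrivial class, the positive part of the circuit has
two elements, and the box consists of `0` and two points of height `k`. -/
lemma box_eq [Nonempty ι] (h : IsCircuit v lam) (hcard : Fintype.card ι = d + 2) {k : ℕ}
    (hδ : HasDeltaPoly (convexHull ℝ (Set.range v)) (1 + X + Polynomial.C 2 * X ^ k))
    (hpos : 2 ≤ (Finset.univ.filter fun i => 0 < lam i).card)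
    {c : ι → ℝ} (hc : c ∈ coeffLattice v) (hcn : ∀ t : ℝ, c - t • lam ∉ intTuples ι) :
    ∃ i₀ i₁ : ι, ∃ g₀ g₁ : ι → ℝ, i₀ ≠ i₁ ∧ (∀ i, 0 < lam i ↔ i = i₀ ∨ i = i₁) ∧
      g₀ ∈ boxSet v lam ∧ g₁ ∈ boxSet v lam ∧ g₀ i₀ = 0 ∧ g₁ i₁ = 0 ∧ g₀ i₁ ≠ 0 ∧ g₁ i₀ ≠ 0 ∧
      (∀ g ∈ boxSet v lam, g = 0 ∨ g = g₀ ∨ g = g₁) ∧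
      (∃ t : ℝ, c - t • lam - g₀ ∈ intTuples ι) ∧ (∃ t : ℝ, c - t • lam - g₁ ∈ intTuples ι) ∧
      ∑ i, g₀ i = k ∧ ∑ i, g₁ i = k := by
  set Γ := h.finite_box.toFinset with hΓ
  have hmem : ∀ g, g ∈ Γ ↔ g ∈ boxSet v lam := fun g => Set.Finite.mem_toFinset _
  set z : (ι → ℝ) → ℕ := fun g => (zeroPlaces lam g).card with hz
  have hsum := h.box_sum_eq hcard hδ
  have htot := weighted_sum_total Γ coeffHeight z k hsum
  have h0mem : (0 : ι → ℝ) ∈ Γ := (hmem 0).2 h.zero_mem_box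
  have h0z : zeroPlaces lam 0 = Finset.univ.filter fun i => 0 < lam i := by
    ext i; simp [mem_zeroPlaces]
  have hclass : ∀ i, 0 < lam i → ∃ g ∈ Γ.erase 0, g i = 0 ∧
      ∃ t : ℝ, c - t • lam - g ∈ intTuples ι := by
    intro i hi
    obtain ⟨g, hg, hgi, t, ht⟩ := h.exists_box_class hc hi
    refine ⟨g, Finset.mem_erase.2 ⟨?_, (hmem g).2 hg⟩, hgi, t, ht⟩
    rintro rfl
    exact hcn t (by simpa using ht)
  rw [← Finset.add_sum_erase Γ _ h0mem] at htot
  have hle : (Finset.univ.filter fun i => 0 < lam i).card ≤ ∑ g ∈ Γ.erase 0, z g := by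
    refine le_trans (Finset.card_le_card ?_) Finset.card_biUnion_le
    intro i hi
    have hi' : 0 < lam i := by simpa using hi
    obtain ⟨g, hg, hgi, _⟩ := hclass i hi'
    exact Finset.mem_biUnion.2 ⟨g, hg, mem_zeroPlaces.2 ⟨hi', hgi⟩⟩
  have hz0 : z 0 = (Finset.univ.filter fun i => 0 < lam i).card := by rw [hz]; simp only [h0z]
  have hz2 : z 0 = 2 := by omega
  have hh := weighted_sum_heights Γ coeffHeight z k 0 h0mem (by simp [coeffHeight]) hz2
    (fun g hg => zeroPlaces_pos ((hmem g).1 hg)) hsum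
  have hcard2 : (Γ.erase 0).card = 2 := by
    have : ∑ g ∈ Γ.erase 0, z g = (Γ.erase 0).card := by
      rw [Finset.card_eq_sum_ones]
      exact Finset.sum_congr rfl fun g hg =>
        (hh g (Finset.mem_of_mem_erase hg) (Finset.ne_of_mem_erase hg)).2
    omega
  obtain ⟨i₀, i₁, hne, hI⟩ := Finset.card_eq_two.1 (hz0.symm.trans hz2)
  have hIiff : ∀ i, 0 < lam i ↔ i = i₀ ∨ i = i₁ := by
    intro i
    have := congrArg (fun s => i ∈ s) hI
    simpa using this
  have hi₀ := (hIiff i₀).2 (Or.inl rfl)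
  have hi₁ := (hIiff i₁).2 (Or.inr rfl)
  obtain ⟨g₀, hg₀, hz₀, ht₀⟩ := hclass i₀ hi₀
  obtain ⟨g₁, hg₁, hz₁, ht₁⟩ := hclass i₁ hi₁
  have hh₀ := hh g₀ (Finset.mem_of_mem_erase hg₀) (Finset.ne_of_mem_erase hg₀)
  have hh₁ := hh g₁ (Finset.mem_of_mem_erase hg₁) (Finset.ne_of_mem_erase hg₁)
  have hone : ∀ g, z g = 1 → g i₀ = 0 → g i₁ = 0 → False := by
    intro g hg h1 h2
    exact hne (Finset.card_le_one.1 hg.le i₀ (mem_zeroPlaces.2 ⟨hi₀, h1⟩) i₁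
      (mem_zeroPlaces.2 ⟨hi₁, h2⟩))
  have hgne : g₀ ≠ g₁ := fun he => hone g₀ hh₀.2 hz₀ (he ▸ hz₁)
  have hΓeq : ({g₀, g₁} : Finset (ι → ℝ)) = Γ.erase 0 := by
    refine Finset.eq_of_subset_of_card_le ?_ ?_
    · intro g hg
      rcases Finset.mem_insert.1 hg with rfl | hg
      · exact hg₀
      · rw [Finset.mem_singleton.1 hg]; exact hg₁
    · rw [hcard2, Finset.card_pair hgne]
  have hb₀ := (hmem g₀).1 (Finset.mem_of_mem_erase hg₀)
  have hb₁ := (hmem g₁).1 (Finset.mem_of_mem_erase hg₁)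
  refine ⟨i₀, i₁, g₀, g₁, hne, hIiff, hb₀, hb₁, hz₀, hz₁, fun h1 => hone g₀ hh₀.2 hz₀ h1,
    fun h1 => hone g₁ hh₁.2 h1 hz₁, fun g hg => ?_, ht₀, ht₁, ?_, ?_⟩
  · by_cases hg0 : g = 0
    · exact Or.inl hg0
    · have : g ∈ ({g₀, g₁} : Finset (ι → ℝ)) := by
        rw [hΓeq]
        exact Finset.mem_erase.2 ⟨hg0, (hmem g).2 hg⟩
      simpa using Or.inr this
  · rw [← coe_height hb₀, hh₀.1]
  · rw [← coe_height hb₁, hh₁.1]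

/-- The circuit is a parallelogram relation, and the lattice is generated by the points together
with one half-integral combination of height `k`. -/
lemma exists_parallelogram [Nonempty ι] (h : IsCircuit v lam) (hcard : Fintype.card ι = d + 2)
    {k : ℕ} (hδ : HasDeltaPoly (convexHull ℝ (Set.range v)) (1 + X + Polynomial.C 2 * X ^ k))
    (hpos : 2 ≤ (Finset.univ.filter fun i => 0 < lam i).card)
    (hneg : 2 ≤ (Finset.univ.filter fun i => lam i < 0).card)
    {c : ι → ℝ} (hc : c ∈ coeffLattice v) (hcn : ∀ t : ℝ, c - t • lam ∉ intTuples ι) :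
    ∃ (ρ g : ι → ℝ) (p₀ p₁ q₀ q₁ : ι), IsCircuit v ρ ∧
      p₀ ≠ p₁ ∧ p₀ ≠ q₀ ∧ p₀ ≠ q₁ ∧ p₁ ≠ q₀ ∧ p₁ ≠ q₁ ∧ q₀ ≠ q₁ ∧
      ρ p₀ = 1 ∧ ρ p₁ = 1 ∧ ρ q₀ = -1 ∧ ρ q₁ = -1 ∧
      (∀ i, i ≠ p₀ → i ≠ p₁ → i ≠ q₀ → i ≠ q₁ → ρ i = 0) ∧
      g p₀ = 1 / 2 ∧ g p₁ = 0 ∧ g q₀ = 1 / 2 ∧ g q₁ = 0 ∧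
      (∀ i, g i = 0 ∨ g i = 1 / 2) ∧ ∑ i, g i = k ∧ g ∈ coeffLattice v ∧
      ∀ b ∈ coeffLattice v, ∃ t : ℝ, b - t • ρ ∈ intTuples ι ∨ b - t • ρ - g ∈ intTuples ι := by
  obtain ⟨i₀, i₁, g₀, g₁, hne, hI, hb₀, hb₁, h00, h11, h01, h10, hbox, hc₀, hc₁, hs₀, hs₁⟩ :=
    h.box_eq hcard hδ hpos hc hcn
  have hi₀ := (hI i₀).2 (Or.inl rfl)
  have hi₁ := (hI i₁).2 (Or.inr rfl)
  obtain ⟨hρ₀, hd₀⟩ := h.integrality hi₀ hcn hbox hb₀ h00 h10 hc₀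
  obtain ⟨hρ₁, hd₁⟩ := h.integrality hi₁ hcn (fun b hb => (hbox b hb).imp_right Or.symm) hb₁ h11
    h01 hc₁
  have heq : lam i₀ = lam i₁ := by
    obtain ⟨a, ha⟩ := mem_intTuples.1 hρ₀ i₁
    obtain ⟨b, hb⟩ := mem_intTuples.1 hρ₁ i₀
    simp only [Pi.smul_apply, smul_eq_mul] at ha hb
    have hapos : (0 : ℝ) < a := ha ▸ mul_pos (inv_pos.2 hi₀) hi₁
    have hab : (a : ℝ) * b = 1 := by
      rw [← ha, ← hb]
      field_simp
    have h1 : a * b = 1 := by exact_mod_cast hab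
    have h2 : 0 < a := by exact_mod_cast hapos
    have h3 : a = 1 := Int.eq_one_of_mul_eq_one_right h2.le h1
    rw [h3] at ha
    field_simp at ha
    simpa using ha.symm
  set ρ := (lam i₀)⁻¹ • lam with hρ
  have hcirc : IsCircuit v ρ := h.smul (inv_ne_zero hi₀.ne')
  have hlam : lam = lam i₀ • ρ := by rw [hρ, smul_smul, mul_inv_cancel₀ hi₀.ne', one_smul]
  have hρi₀ : ρ i₀ = 1 := by simp [hρ, inv_mul_cancel₀ hi₀.ne']
  have hρi₁ : ρ i₁ = 1 := by simp [hρ, heq, inv_mul_cancel₀ hi₁.ne']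
  have hρint := mem_intTuples.1 hρ₀
  have hρneg : ∀ i, ρ i < 0 ↔ lam i < 0 := by
    intro i
    rw [hρ, Pi.smul_apply, smul_eq_mul, ← neg_pos, ← mul_neg, mul_pos_iff_of_pos_left
      (inv_pos.2 hi₀), neg_pos]
  set J := Finset.univ.filter fun i => lam i < 0 with hJ
  have hJsum : ∑ i ∈ J, ρ i = -2 := by
    have h1 : ∑ i ∈ ({i₀, i₁} ∪ J : Finset ι), ρ i = 0 := by
      rw [← hcirc.sum_zero]
      refine Finset.sum_subset (Finset.subset_univ _) fun i _ hi => ?_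
      simp only [Finset.mem_union, Finset.mem_insert, Finset.mem_singleton, hJ,
        Finset.mem_filter, Finset.mem_univ, true_and, ← hI, not_or, not_lt] at hi
      rw [hρ, Pi.smul_apply, le_antisymm hi.1 hi.2, smul_zero]
    rw [Finset.sum_union, Finset.sum_pair hne, hρi₀, hρi₁] at h1
    · linarith
    · rw [Finset.disjoint_left]
      intro i hi hiJ
      simp only [Finset.mem_insert, Finset.mem_singleton, ← hI] at hi
      simp only [hJ, Finset.mem_filter, Finset.mem_univ, true_and] at hiJ
      exact lt_asymm hi hiJ
  obtain ⟨hJ2, hJone⟩ := neg_one_of_sum_eq_neg_two J ρ (fun i _ => hρint i)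
    (fun i hi => (hρneg i).2 (by simpa [hJ] using hi)) hneg hJsum
  obtain ⟨j₀, j₁, hjne, hJeq⟩ := Finset.card_eq_two.1 hJ2
  have hJiff : ∀ i, lam i < 0 ↔ i = j₀ ∨ i = j₁ := by
    intro i
    have := congrArg (fun s => i ∈ s) hJeq
    simpa [hJ] using this
  have hρj₀ : ρ j₀ = -1 := hJone j₀ (by simp [hJeq])
  have hρj₁ : ρ j₁ = -1 := hJone j₁ (by simp [hJeq])
  have hρother : ∀ i, i ≠ i₀ → i ≠ i₁ → i ≠ j₀ → i ≠ j₁ → ρ i = 0 := by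
    intro i a1 a2 a3 a4
    have b1 : ¬ 0 < lam i := by rw [hI]; tauto
    have b2 : ¬ lam i < 0 := by rw [hJiff]; tauto
    rw [hρ, Pi.smul_apply, le_antisymm (not_lt.1 b1) (not_lt.1 b2), smul_zero]
  have hij : ∀ i j, (i = i₀ ∨ i = i₁) → (j = j₀ ∨ j = j₁) → i ≠ j := by
    rintro i j hi hj rfl
    exact lt_asymm ((hI i).2 hi) ((hJiff i).2 hj)
  have hhalf₀ : ∀ i, g₀ i = 0 ∨ g₀ i = 1 / 2 := fun i =>
    half_of_two_mul_int (hb₀.1 i).1 (hb₀.1 i).2 (by simpa using mem_intTuples.1 hd₀ i)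
  have hhalf₁ : ∀ i, g₁ i = 0 ∨ g₁ i = 1 / 2 := fun i =>
    half_of_two_mul_int (hb₁.1 i).1 (hb₁.1 i).2 (by simpa using mem_intTuples.1 hd₁ i)
  have hg01 := (hhalf₀ i₁).resolve_left h01
  have hg10 := (hhalf₁ i₀).resolve_left h10
  obtain ⟨s, hs⟩ : ∃ s : ℝ, g₁ - g₀ - s • ρ ∈ intTuples ι := by
    obtain ⟨t₀, ht₀⟩ := hc₀
    obtain ⟨t₁, ht₁⟩ := hc₁
    refine ⟨(t₀ - t₁) * lam i₀, ?_⟩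
    convert sub_mem ht₀ ht₁ using 1
    rw [mul_smul, ← hlam]
    module
  have hdiff := mem_intTuples.1 hs
  simp only [Pi.sub_apply, Pi.smul_apply, smul_eq_mul] at hdiff
  obtain ⟨a, ha⟩ := hdiff i₀
  rw [hρi₀, hg10, h00] at ha
  have hflip : ∀ j, ρ j = -1 → g₁ j = 1 / 2 - g₀ j := by
    intro j hj
    obtain ⟨b, hb⟩ := hdiff j
    rw [hj] at hb
    have hne1 : g₁ j - g₀ j ≠ 0 := by
      intro h0
      have h1 : (2 * (a + b) : ℝ) = 1 := by linarith
      have h2 : 2 * (a + b) = 1 := by exact_mod_cast h1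
      omega
    rcases hhalf₀ j with h1 | h1 <;> rcases hhalf₁ j with h2 | h2 <;> rw [h1, h2] at hne1 ⊢ <;>
      first | (norm_num; done) | exact absurd (by norm_num) hne1
  have hsame : ∀ j, ρ j = 0 → g₁ j = g₀ j := by
    intro j hj
    obtain ⟨b, hb⟩ := hdiff j
    rw [hj, mul_zero, sub_zero] at hb
    have hodd : ∀ x : ℝ, x = 1 / 2 ∨ x = -(1 / 2) → x ≠ b := by
      intro x hx hxb
      have h1 : (2 * b : ℝ) = 1 ∨ (2 * b : ℝ) = -1 := by
        rcases hx with h1 | h1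
        · left; linarith
        · right; linarith
      have h2 : 2 * b = 1 ∨ 2 * b = -1 := by exact_mod_cast h1
      omega
    rcases hhalf₀ j with h1 | h1 <;> rcases hhalf₁ j with h2 | h2 <;> rw [h1, h2] at hb ⊢
    · exact absurd hb (hodd _ (by norm_num))
    · exact absurd hb (hodd _ (by norm_num))
  have hjsum : g₀ j₀ + g₀ j₁ = 1 / 2 := by
    have h1 : ∑ i, (g₁ i - g₀ i) = 0 := by rw [Finset.sum_sub_distrib, hs₀, hs₁, sub_self]
    rw [← Finset.sum_subset (Finset.subset_univ ({i₀, i₁, j₀, j₁} : Finset ι))] at h1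
    · rw [Finset.sum_insert, Finset.sum_insert, Finset.sum_pair hjne, hflip _ hρj₀,
        hflip _ hρj₁, h00, hg10, h11, hg01] at h1
      · linarith
      · have := hij i₁ j₀ (by simp) (by simp)
        have := hij i₁ j₁ (by simp) (by simp)
        simp [*]
      · have := hij i₀ j₀ (by simp) (by simp)
        have := hij i₀ j₁ (by simp) (by simp)
        simp [*]
    · intro i _ hi
      simp only [Finset.mem_insert, Finset.mem_singleton, not_or] at hi
      rw [hsame i (hρother i hi.1 hi.2.1 hi.2.2.1 hi.2.2.2), sub_self]
  have hdecomp : ∀ b ∈ coeffLattice v, ∃ t : ℝ,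
      b - t • ρ ∈ intTuples ι ∨ b - t • ρ - g₀ ∈ intTuples ι := by
    intro b hb
    obtain ⟨g, hg, hgi, t, ht⟩ := h.exists_box_class hb hi₀
    refine ⟨t * lam i₀, ?_⟩
    rw [mul_smul, ← hlam]
    rcases hbox g hg with rfl | rfl | rfl
    · exact Or.inl (by simpa using ht)
    · exact Or.inr ht
    · exact absurd hgi h10
  rcases hhalf₀ j₀ with hj | hj
  · exact ⟨ρ, g₀, i₁, i₀, j₁, j₀, hcirc, hne.symm, hij _ _ (by simp) (by simp),
      hij _ _ (by simp) (by simp), hij _ _ (by simp) (by simp), hij _ _ (by simp) (by simp),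
      hjne.symm, hρi₁, hρi₀, hρj₁, hρj₀, fun i a1 a2 a3 a4 => hρother i a2 a1 a4 a3, hg01, h00,
      by linarith, hj, hhalf₀, hs₀, hb₀.2.1, hdecomp⟩
  · exact ⟨ρ, g₀, i₁, i₀, j₀, j₁, hcirc, hne.symm, hij _ _ (by simp) (by simp),
      hij _ _ (by simp) (by simp), hij _ _ (by simp) (by simp), hij _ _ (by simp) (by simp),
      hjne, hρi₁, hρi₀, hρj₀, hρj₁, fun i a1 a2 a3 a4 => hρother i a2 a1 a3 a4, hg01, h00,
      hj, by linarith, hhalf₀, hs₀, hb₀.2.1, hdecomp⟩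

end IsCircuit

lemma ncard_latticePts_of_deltaPoly {d k : ℕ} (hk : 2 ≤ k) {P : Set (Fin d → ℝ)}
    (hδ : HasDeltaPoly P (1 + X + Polynomial.C 2 * X ^ k)) :
    (latticePts d ∩ P).ncard = d + 2 := by
  have h1 := congrArg (PowerSeries.coeff 1) hδ
  have hk1 : ¬ (1 = k) := by omega
  rw [PowerSeries.coeff_one_mul, PowerSeries.coeff_one_pow, Polynomial.coeff_coe] at h1
  have hc : PowerSeries.constantCoeff (ehrhartSeries P) = 1 := by
    rw [← PowerSeries.coeff_zero_eq_constantCoeff, ehrhartSeries, PowerSeries.coeff_mk, if_pos rfl]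
  have hc1 : PowerSeries.coeff 1 (ehrhartSeries P) = (latticePts d ∩ P).ncard := by
    rw [ehrhartSeries, PowerSeries.coeff_mk, if_neg one_ne_zero, ehrhartCount, Nat.cast_one,
      one_smul]
  rw [hc, hc1] at h1
  simp [Polynomial.coeff_X_pow, Polynomial.coeff_one, hk1] at h1
  have h2 : (((latticePts d ∩ P).ncard : ℕ) : ℤ) = ((d + 2 : ℕ) : ℤ) := by
    push_cast
    linarith
  exact_mod_cast h2

/-- A lattice polytope with `d + 2` lattice points is the convex hull of a spanning configuration
with a single affine relation. -/
lemma exists_isCircuit {d : ℕ} {P : Set (Fin d → ℝ)} (hP : IsLatticePolytope P)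
    (hdim : affineSpan ℝ P = ⊤) (hcard : (latticePts d ∩ P).ncard = d + 2) :
    ∃ (v : Fin (d + 2) → Fin d → ℝ) (lam : Fin (d + 2) → ℝ), IsCircuit v lam ∧
      P = convexHull ℝ (Set.range v) ∧ Set.range v = latticePts d ∩ P := by
  have hfin : (latticePts d ∩ P).Finite := Set.finite_of_ncard_pos (by omega)
  have hcard' : hfin.toFinset.card = d + 2 := by rw [← Set.ncard_eq_toFinset_card _ hfin, hcard]
  set v : Fin (d + 2) → Fin d → ℝ := fun i => ((hfin.toFinset.equivFinOfCardEq hcard').symm i).1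
    with hv
  have hrange : Set.range v = latticePts d ∩ P := by
    ext x
    constructor
    · rintro ⟨i, rfl⟩
      exact hfin.mem_toFinset.1 ((hfin.toFinset.equivFinOfCardEq hcard').symm i).2
    · intro hx
      exact ⟨hfin.toFinset.equivFinOfCardEq hcard' ⟨x, hfin.mem_toFinset.2 hx⟩, by simp [hv]⟩
  have hconv : P = convexHull ℝ (Set.range v) := by
    obtain ⟨V, hV, rfl⟩ := hP
    rw [hrange]
    refine subset_antisymm (convexHull_mono fun x hx => ⟨hV hx, subset_convexHull ℝ _ hx⟩) ?_
    exact convexHull_min Set.inter_subset_right (convex_convexHull ℝ _)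
  have hspan : affineSpan ℝ (Set.range v) = ⊤ := by
    rw [← hdim, hconv, affineSpan_convexHull]
  let T : (Fin (d + 2) → ℝ) →ₗ[ℝ] (Fin d → ℝ) × ℝ :=
    (Fintype.linearCombination ℝ v).prod (Fintype.linearCombination ℝ fun _ => (1 : ℝ))
  have hT : ∀ c, T c = (∑ i, c i • v i, ∑ i, c i) := by
    intro c
    simp [T, Fintype.linearCombination_apply]
  have hsurj : Function.Surjective T := by
    have hone : ∀ x, ∃ c, T c = (x, 1) := by
      intro x
      have hx : x ∈ affineSpan ℝ (Set.range v) := by rw [hspan]; trivial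
      obtain ⟨w, hw, rfl⟩ := eq_affineCombination_of_mem_affineSpan_of_fintype hx
      refine ⟨w, ?_⟩
      rw [hT, Finset.affineCombination_eq_linear_combination _ _ _ hw, hw]
    rintro ⟨x, t⟩
    obtain ⟨c, hc⟩ := hone x
    obtain ⟨c₀, hc₀⟩ := hone 0
    exact ⟨c + (t - 1) • c₀, by simp [hc, hc₀]⟩
  have hker : Module.finrank ℝ (LinearMap.ker T) = 1 := by
    have := T.finrank_range_add_finrank_ker
    rw [LinearMap.range_eq_top.2 hsurj, finrank_top, Module.finrank_prod] at this
    simp at this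
    omega
  obtain ⟨⟨lam, hlam⟩, hne, huniq⟩ := finrank_eq_one_iff'.1 hker
  rw [LinearMap.mem_ker, hT, Prod.mk_eq_zero] at hlam
  refine ⟨v, lam, ⟨fun i => ?_, fun h0 => hne (Subtype.ext h0), hlam.2, hlam.1, ?_, ?_⟩, hconv,
    hrange⟩
  · exact (hrange.subset ⟨i, rfl⟩).1
  · intro μ h1 h2
    obtain ⟨t, ht⟩ := huniq ⟨μ, by rw [LinearMap.mem_ker, hT, h1, h2]; rfl⟩
    exact ⟨t, (congrArg Subtype.val ht).symm⟩
  · intro x t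
    obtain ⟨c, hc⟩ := hsurj (x, t)
    rw [hT, Prod.mk.injEq] at hc
    exact ⟨c, hc.2, hc.1⟩

namespace IsCircuit

lemma two_le_card_pos {d : ℕ} {v : Fin (d + 2) → Fin d → ℝ} {lam : Fin (d + 2) → ℝ}
    (h : IsCircuit v lam) (hns : ¬ IsSimplex (convexHull ℝ (Set.range v))) :
    2 ≤ (Finset.univ.filter fun i => 0 < lam i).card := by
  obtain ⟨i₀, hi₀⟩ := h.exists_pos
  by_contra hlt
  have hle : (Finset.univ.filter fun i => 0 < lam i).card ≤ 1 := by omega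
  have hneg : ∀ i, i ≠ i₀ → lam i ≤ 0 := by
    intro i hi
    by_contra hpos
    exact hi (Finset.card_le_one.1 hle i (by simpa using hpos) i₀ (by simpa using hi₀))
  apply hns
  refine ⟨d, v ∘ i₀.succAbove, ?_, ?_⟩
  · rw [affineIndependent_iff_of_fintype]
    intro w hw hw'
    rw [Finset.univ.weightedVSub_eq_linear_combination hw] at hw'
    obtain ⟨t, ht⟩ := h.unique (i₀.insertNth 0 w) (by simp [Fin.sum_univ_succAbove _ i₀, hw])
      (by simpa [Fin.sum_univ_succAbove _ i₀] using hw')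
    have ht0 : t = 0 := by
      have := congrFun ht i₀
      simpa [hi₀.ne'] using this.symm
    intro i
    have := congrFun ht (i₀.succAbove i)
    simpa [ht0] using this
  · refine subset_antisymm (convexHull_min ?_ (convex_convexHull ℝ _))
      (convexHull_mono (Set.range_comp_subset_range _ _))
    rintro _ ⟨i, rfl⟩
    have hmem : ∀ j, v (i₀.succAbove j) ∈ convexHull ℝ (Set.range (v ∘ i₀.succAbove)) :=
      fun j => subset_convexHull ℝ _ ⟨j, rfl⟩
    rcases Fin.eq_self_or_eq_succAbove i₀ i with rfl | ⟨j, rfl⟩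
    · have h1 := h.sum_zero
      have h2 := h.comb_zero
      rw [Fin.sum_univ_succAbove _ i] at h1 h2
      have hv : v i = ∑ j, (-lam (i.succAbove j) / lam i) • v (i.succAbove j) := by
        have : lam i • v i = ∑ j, -lam (i.succAbove j) • v (i.succAbove j) := by
          simp only [neg_smul, Finset.sum_neg_distrib]
          exact eq_neg_of_add_eq_zero_left h2
        rw [← inv_smul_smul₀ hi₀.ne' (v i), this, Finset.smul_sum]
        refine Finset.sum_congr rfl fun j _ => ?_
        rw [smul_smul, inv_mul_eq_div]
      rw [hv]
      refine (convex_convexHull ℝ _).sum_mem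
        (fun j _ => div_nonneg (neg_nonneg.2 (hneg _ (Fin.succAbove_ne _ _))) hi₀.le) ?_
        fun j _ => hmem j
      rw [← Finset.sum_div, Finset.sum_neg_distrib, ← eq_neg_of_add_eq_zero_left h1,
        div_self hi₀.ne']
    · exact hmem j

lemma two_le_card_neg {d : ℕ} {v : Fin (d + 2) → Fin d → ℝ} {lam : Fin (d + 2) → ℝ}
    (h : IsCircuit v lam) (hns : ¬ IsSimplex (convexHull ℝ (Set.range v))) :
    2 ≤ (Finset.univ.filter fun i => lam i < 0).card := by
  simpa using h.neg.two_le_card_pos hns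

/-- If the lattice points do not generate the lattice, some coefficient vector of a lattice point
is not integral modulo the relations. -/
lemma exists_nontrivial_class {d : ℕ} {ι : Type*} [Fintype ι] {v : ι → Fin d → ℝ} {lam : ι → ℝ}
    (h : IsCircuit v lam) {P : Set (Fin d → ℝ)} (hrange : Set.range v ⊆ P)
    (hspan : ¬ SpansLattice P) :
    ∃ c ∈ coeffLattice v, ∀ t : ℝ, c - t • lam ∉ intTuples ι := by
  by_contra! hall
  apply hspan
  rw [SpansLattice, eq_top_iff]
  intro y _
  obtain ⟨c, hc1, hc2⟩ := h.span (fun j => (y j.castSucc : ℝ)) (y (Fin.last d))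
  obtain ⟨t, m, hm⟩ := hall c ⟨⟨_, hc1⟩, by rw [hc2]; exact fun j => ⟨_, rfl⟩⟩
  have hm' : ∀ i, (m i : ℝ) = c i - t * lam i := fun i => by simpa using congrFun hm i
  choose a ha using h.int
  have hy : y = ∑ i, m i • (Fin.snoc (a i) 1 : Fin (d + 1) → ℤ) := by
    ext j
    rw [← Int.cast_inj (α := ℝ)]
    refine Fin.lastCases ?_ (fun j => ?_) j
    · simp [hm', Finset.sum_sub_distrib, ← Finset.mul_sum, h.sum_zero, hc1]
    · have h1 := congrFun hc2 j
      have h2 := congrFun h.comb_zero j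
      simp only [Finset.sum_apply, Pi.smul_apply, smul_eq_mul, Pi.zero_apply] at h1 h2
      simp [hm', ← ha, sub_mul, Finset.sum_sub_distrib, h1, mul_assoc, ← Finset.mul_sum, h2]
  rw [hy]
  refine sum_mem fun i _ => ?_
  have hv : (fun j : Fin d => (((Fin.snoc (a i) 1 : Fin (d + 1) → ℤ) j.castSucc : ℤ) : ℝ)) = v i := by
    ext j
    simp [ha]
  have hmem : (Fin.snoc (a i) 1 : Fin (d + 1) → ℤ) ∈ {y : Fin (d + 1) → ℤ |
      y (Fin.last d) = 1 ∧ (fun i : Fin d => (y i.castSucc : ℝ)) ∈ P} := by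
    refine ⟨by simp, ?_⟩
    rw [hv]
    exact hrange ⟨i, rfl⟩
  exact zsmul_mem (AddSubgroup.subset_closure hmem) _

end IsCircuit

lemma UnimodEquiv.of_affineEquiv {d : ℕ} (G : (Fin d → ℝ) ≃ᵃ[ℝ] (Fin d → ℝ))
    (hG : ∀ y, G y ∈ latticePts d ↔ y ∈ latticePts d) {P B : Set (Fin d → ℝ)}
    (hP : affineSpan ℝ P = ⊤) (hB : G '' B = P) : UnimodEquiv P B := by
  have hsymm : G.symm '' P = B := by
    rw [← hB, Set.image_image]
    simp
  have hBspan : affineSpan ℝ B = ⊤ := by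
    rw [← hsymm]
    exact (AffineEquiv.span_eq_top_iff G.symm).1 hP
  refine ⟨G.symm, ?_, hsymm⟩
  rw [hP, hBspan]
  simp only [AffineSubspace.top_coe, Set.inter_univ]
  refine ⟨fun x hx => (hG _).1 (by simpa using hx), G.symm.injective.injOn, fun y hy =>
    ⟨G y, (hG y).2 hy, by simp⟩⟩

/-- A family of `d` lattice vectors generating `ℤ^d` gives affine lattice coordinates. -/
lemma exists_latticeEquiv {d : ℕ} {o : Fin d → ℝ} {w : Fin d → Fin d → ℝ}
    (ho : o ∈ latticePts d) (hw : ∀ j, w j ∈ latticePts d)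
    (hspan : ∀ x ∈ latticePts d, x ∈ Submodule.span ℤ (Set.range w)) :
    ∃ G : (Fin d → ℝ) ≃ᵃ[ℝ] (Fin d → ℝ), (∀ y, G y ∈ latticePts d ↔ y ∈ latticePts d) ∧
      ∀ y, G y = o + ∑ j, y j • w j := by
  have hsurj : Function.Surjective (Fintype.linearCombination ℝ w) := by
    rw [← LinearMap.range_eq_top, Fintype.range_linearCombination, eq_top_iff,
      ← (Pi.basisFun ℝ (Fin d)).span_eq, Submodule.span_le]
    rintro _ ⟨j, rfl⟩
    refine Submodule.span_subset_span ℤ ℝ _ (hspan _ fun i => ?_)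
    by_cases hij : i = j
    · exact ⟨1, by simp [hij]⟩
    · exact ⟨0, by simp [hij]⟩
  have hinj := LinearMap.injective_iff_surjective.2 hsurj
  let L := LinearEquiv.ofBijective (Fintype.linearCombination ℝ w) ⟨hinj, hsurj⟩
  have hL : ∀ y, L y = ∑ j, y j • w j := fun y =>
    Fintype.linearCombination_apply ℝ w y
  refine ⟨L.toAffineEquiv.trans (AffineEquiv.constVAdd ℝ _ o), ?_, fun y => by simp [hL]⟩
  intro y
  have hy : (L.toAffineEquiv.trans (AffineEquiv.constVAdd ℝ _ o)) y = o + L y := by simp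
  rw [hy]
  constructor
  · intro hlat
    have h1 : L y ∈ latticeSubgroup d := by
      simpa using sub_mem (mem_latticeSubgroup.2 hlat) (mem_latticeSubgroup.2 ho)
    obtain ⟨z, hz⟩ := (Submodule.mem_span_range_iff_exists_fun ℤ).1 (hspan _ h1)
    have h2 : y = fun j => (z j : ℝ) := by
      apply L.injective
      rw [hL (fun j => (z j : ℝ)), ← hz]
      simp only [Int.cast_smul_eq_zsmul]
    exact fun j => ⟨z j, congrFun h2 j⟩
  · intro hlat
    choose z hz using hlat
    rw [← mem_latticeSubgroup, hL]
    refine add_mem (mem_latticeSubgroup.2 ho) (sum_mem fun j _ => ?_)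
    rw [hz, Int.cast_smul_eq_zsmul]
    exact zsmul_mem (mem_latticeSubgroup.2 (hw j)) _

namespace IsCircuit

/-- A coordinate in which all coefficient vectors of lattice points are integral is, on vectors
of the lattice, given by an integral linear form. -/
lemma exists_coordinate_form {d : ℕ} {ι : Type*} [Fintype ι] {v : ι → Fin d → ℝ} {ρ : ι → ℝ}
    (h : IsCircuit v ρ) {r : ι} (hr : ρ r = 0) (hint : ∀ c ∈ coeffLattice v, ∃ z : ℤ, c r = z) :
    ∃ a : Fin d → ℤ, ∀ c : ι → ℝ, ∑ i, c i = 0 → c r = ∑ j, (∑ i, c i • v i) j * a j := by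
  classical
  have hex : ∀ j : Fin d, ∃ c : ι → ℝ, ∑ i, c i = 0 ∧ ∑ i, c i • v i = Pi.single j 1 :=
    fun j => h.span _ _
  choose b hb0 hb using hex
  have hbz : ∀ j, ∃ z : ℤ, b j r = z := fun j => by
    refine hint _ ⟨⟨0, by simp [hb0]⟩, ?_⟩
    rw [hb]
    intro i
    by_cases hij : i = j
    · exact ⟨1, by simp [hij]⟩
    · exact ⟨0, by simp [hij]⟩
  choose a ha using hbz
  refine ⟨a, fun c hc => ?_⟩
  set x := ∑ i, c i • v i with hx
  obtain ⟨t, ht⟩ := h.unique (fun i => c i - ∑ j, x j * b j i) (by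
      rw [Finset.sum_sub_distrib, Finset.sum_comm, hc]
      simp [← Finset.mul_sum, hb0]) (by
      simp only [sub_smul, Finset.sum_sub_distrib, Finset.sum_smul, mul_smul]
      rw [Finset.sum_comm]
      simp only [← Finset.smul_sum, hb, ← hx]
      rw [← pi_eq_sum_univ' x, sub_self])
  have := congrFun ht r
  simp only [Pi.smul_apply, hr, smul_zero] at this
  rw [sub_eq_zero.1 this]
  exact Finset.sum_congr rfl fun j _ => by rw [ha]

/-- A point outside the affine relation in which all coefficients are integral is the apex of a
lattice pyramid. -/
lemma isLatticePyramid {d : ℕ} {ι : Type*} [Fintype ι] {v : ι → Fin d → ℝ} {ρ : ι → ℝ}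
    (h : IsCircuit v ρ) {r o : ι} (hro : o ≠ r) (hr : ρ r = 0)
    (hint : ∀ c ∈ coeffLattice v, ∃ z : ℤ, c r = z) :
    IsLatticePyramid (convexHull ℝ (Set.range v)) := by
  classical
  obtain ⟨a, ha⟩ := h.exists_coordinate_form hr hint
  have hcoord : ∀ c : ι → ℝ, ∑ i, c i = 1 →
      c r = ∑ j, (∑ i, c i • v i - v o) j * a j := by
    intro c hc
    have := ha (c - Pi.single o 1) (by simp [hc])
    have hs : ∑ i, (Pi.single o 1 : ι → ℝ) i • v i = v o := by simp [Pi.single_apply]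
    simp only [Pi.sub_apply, sub_smul, Finset.sum_sub_distrib, hs] at this
    simpa [hro.symm] using this
  have hvr : ∑ j, (v r - v o) j * a j = 1 := by
    have := hcoord (Pi.single r 1) (by simp)
    have hs : ∑ i, (Pi.single r 1 : ι → ℝ) i • v i = v r := by simp [Pi.single_apply]
    rw [hs] at this
    simpa using this.symm
  have hvi : ∀ i, i ≠ r → ∑ j, (v i - v o) j * a j = 0 := by
    intro i hi
    have := hcoord (Pi.single i 1) (by simp)
    have hs : ∑ l, (Pi.single i 1 : ι → ℝ) l • v l = v i := by simp [Pi.single_apply]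
    rw [hs] at this
    simpa [hi.symm] using this.symm
  obtain ⟨e, rfl⟩ : ∃ e, d = e + 1 := by
    refine Nat.exists_eq_succ_of_ne_zero ?_
    rintro rfl
    simp at hvr
  choose n hn using h.int
  have hu : ∑ j, (n r - n o) j * a j = 1 := by
    have : ((∑ j, (n r - n o) j * a j : ℤ) : ℝ) = 1 := by
      rw [← hvr]
      push_cast
      simp [hn]
    exact_mod_cast this
  let ψ : (Fin (e + 1) → ℤ) →ₗ[ℤ] ℤ := Fintype.linearCombination ℤ a
  have hψ : ∀ z, ψ z = ∑ j, z j * a j := fun z => by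
    simp [ψ, Fintype.linearCombination_apply]
  have hψsurj : Function.Surjective ψ := fun m => ⟨m • (n r - n o), by rw [map_smul, hψ, hu]; simp⟩
  have hker : Module.finrank ℤ (LinearMap.ker ψ) = e := by
    have := Submodule.finrank_quotient_add_finrank (LinearMap.ker ψ)
    rw [(ψ.quotKerEquivOfSurjective hψsurj).finrank_eq, Module.finrank_self,
      Module.finrank_fin_fun] at this
    omega
  let b := Module.finBasisOfFinrankEq ℤ (LinearMap.ker ψ) hker
  let w : Fin (e + 1) → Fin (e + 1) → ℝ :=
    Fin.snoc (fun i : Fin e => fun j => (((b i : Fin (e + 1) → ℤ) j : ℤ) : ℝ)) (v r - v o)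
  have hwc : ∀ i : Fin e, w i.castSucc = fun j => (((b i : Fin (e + 1) → ℤ) j : ℤ) : ℝ) :=
    fun i => by simp [w]
  have hwl : w (Fin.last e) = v r - v o := by simp [w]
  have hwa : ∀ y : Fin (e + 1) → ℝ, ∑ j, (∑ i, y i • w i) j * a j = y (Fin.last e) := by
    intro y
    have hb : ∀ i : Fin e, ∑ j, w i.castSucc j * a j = 0 := by
      intro i
      have h1 := (b i).2
      rw [LinearMap.mem_ker, hψ] at h1
      rw [hwc]
      beta_reduce
      exact_mod_cast h1
    simp only [Finset.sum_apply, Pi.smul_apply, smul_eq_mul, Finset.sum_mul, mul_assoc]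
    rw [Finset.sum_comm]
    simp only [← Finset.mul_sum]
    rw [Fin.sum_univ_castSucc]
    simp only [hb, hwl, hvr, mul_zero, mul_one, Finset.sum_const_zero, zero_add]
  obtain ⟨G, hGlat, hG⟩ := exists_latticeEquiv (o := v o) (w := w) (h.int o) (by
      intro j
      refine Fin.lastCases ?_ (fun i => ?_) j
      · rw [hwl]
        exact sub_mem (mem_latticeSubgroup.2 (h.int r)) (mem_latticeSubgroup.2 (h.int o))
      · rw [hwc]
        exact fun j => ⟨_, rfl⟩) (by
      intro x hx
      choose z hz using hx
      have hmem : z - ψ z • (n r - n o) ∈ LinearMap.ker ψ := by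
        rw [LinearMap.mem_ker, map_sub, map_smul, hψ (n r - n o), hu]
        simp
      have hsum := congrArg Subtype.val (b.sum_repr ⟨_, hmem⟩)
      set y := b.repr ⟨_, hmem⟩ with hy
      refine (Submodule.mem_span_range_iff_exists_fun ℤ).2 ⟨Fin.snoc y (ψ z), ?_⟩
      rw [Fin.sum_univ_castSucc]
      simp only [Fin.snoc_castSucc, Fin.snoc_last, hwc, hwl]
      ext j
      have hj := congrArg (Int.cast : ℤ → ℝ) (congrFun hsum j)
      simp [← hn] at hj ⊢
      rw [hj, hz]
      ring)
  have hGlast : ∀ y, ∑ j, (G y - v o) j * a j = y (Fin.last e) := by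
    intro y
    rw [hG, add_sub_cancel_left, hwa]
  have hsymm_last : ∀ x, G.symm x (Fin.last e) = ∑ j, (x - v o) j * a j := by
    intro x
    rw [← hGlast (G.symm x), G.apply_symm_apply]
  let v' : ι → Fin (e + 1) → ℝ := Function.update v r (v o)
  let q : ι → Fin e → ℝ := fun i => Fin.init (G.symm (v' i))
  have hq : ∀ i, (Fin.snoc (q i) 0 : Fin (e + 1) → ℝ) = G.symm (v' i) := by
    intro i
    have : G.symm (v' i) (Fin.last e) = 0 := by
      rw [hsymm_last]
      by_cases hi : i = r
      · simp [v', hi]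
      · simpa [v', hi] using hvi i hi
    rw [← this]
    exact Fin.snoc_init_self _
  have hv'int : ∀ i, v' i ∈ latticePts (e + 1) := by
    intro i
    by_cases hi : i = r
    · simpa [v', hi] using h.int o
    · simpa [v', hi] using h.int i
  have hapex : G.symm (v r) = (Fin.snoc (0 : Fin e → ℝ) (1 : ℝ) : Fin (e + 1) → ℝ) := by
    rw [AffineEquiv.symm_apply_eq, hG, Fin.sum_univ_castSucc]
    simp [hwl]
  refine ⟨e, convexHull ℝ (Set.range q), ⟨Finset.univ.image q, ?_, by simp⟩, ?_, ?_⟩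
  · intro x hx
    obtain ⟨i, rfl⟩ : ∃ i, q i = x := by simpa using hx
    have := (hGlat (G.symm (v' i))).1 (by simpa using hv'int i)
    exact fun j => this j.castSucc
  · rw [affineSpan_convexHull, eq_top_iff]
    intro x _
    obtain ⟨c, hc1, hc2⟩ := h.span (G (Fin.snoc x 0)) 1
    have hcr : c r = 0 := by
      rw [hcoord c hc1, hc2, hGlast]
      simp
    have hc3 : ∑ i, c i • v' i = G (Fin.snoc x 0) := by
      rw [← hc2]
      refine Finset.sum_congr rfl fun i _ => ?_
      by_cases hi : i = r
      · simp [hi, hcr]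
      · simp [v', hi]
    have hx : x = ∑ i, c i • q i := by
      have h1 := Finset.univ.map_affineCombination v' c hc1 G.symm.toAffineMap
      rw [Finset.affineCombination_eq_linear_combination _ _ _ hc1,
        Finset.affineCombination_eq_linear_combination _ _ _ hc1, hc3] at h1
      ext j
      have h2 := congrFun h1 j.castSucc
      simpa [q, Fin.init] using h2
    rw [hx, ← Finset.affineCombination_eq_linear_combination _ _ _ hc1]
    exact affineCombination_mem_affineSpan hc1 q
  · refine UnimodEquiv.of_affineEquiv G hGlat ?_ ?_
    · rw [affineSpan_convexHull, eq_top_iff]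
      intro x _
      obtain ⟨c, hc1, rfl⟩ := h.span x 1
      rw [← Finset.affineCombination_eq_linear_combination _ _ _ hc1]
      exact affineCombination_mem_affineSpan hc1 v
    · have hsnoc : IsLinearMap ℝ fun x : Fin e → ℝ => (Fin.snoc x 0 : Fin (e + 1) → ℝ) := by
        constructor
        · intro x y
          ext j
          refine Fin.lastCases ?_ (fun i => ?_) j <;> simp
        · intro t x
          ext j
          refine Fin.lastCases ?_ (fun i => ?_) j <;> simp
      rw [pyramidOver, hsnoc.image_convexHull, convexHull_convexHull_union_left,
        ← AffineEquiv.coe_toAffineMap, AffineMap.image_convexHull, AffineEquiv.coe_toAffineMap,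
        ← Set.range_comp, Set.image_union, Set.image_singleton, ← hapex, G.apply_symm_apply,
        ← Set.range_comp]
      congr 1
      have hG' : (⇑G ∘ (fun x : Fin e → ℝ => (Fin.snoc x 0 : Fin (e + 1) → ℝ)) ∘ q) = v' := by
        ext1 i
        simp only [Function.comp_apply, hq, G.apply_symm_apply]
      rw [hG']
      ext x
      constructor
      · rintro (⟨i, rfl⟩ | rfl)
        · by_cases hi : i = r
          · exact ⟨o, by simp [v', hi]⟩
          · exact ⟨i, by simp [v', hi]⟩
        · exact ⟨r, rfl⟩
      · rintro ⟨i, rfl⟩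
        by_cases hi : i = r
        · exact Or.inr (by simp [hi])
        · exact Or.inl ⟨i, by simp [v', hi]⟩

end IsCircuit

lemma exists_enumeration {ι : Type*} [Fintype ι] [DecidableEq ι] {n : ℕ}
    (hcard : Fintype.card ι = n + 2) {j₀ j₁ : Fin n} (hj : j₀ ≠ j₁) {p₀ p₁ q₀ q₁ : ι}
    (hp : p₀ ≠ p₁) (h₀₀ : p₀ ≠ q₀) (h₀₁ : p₀ ≠ q₁) (h₁₀ : p₁ ≠ q₀) (h₁₁ : p₁ ≠ q₁)
    (hq : q₀ ≠ q₁) :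
    ∃ σ : Option (Option (Fin n)) ≃ ι, σ none = p₀ ∧ σ (some none) = q₁ ∧
      σ (some (some j₀)) = q₀ ∧ σ (some (some j₁)) = p₁ := by
  let f : Option (Option (Fin n)) → ι := fun x =>
    x.elim p₀ fun y => y.elim q₁ fun j => if j = j₀ then q₀ else p₁
  obtain ⟨g, hg⟩ := Finset.exists_equiv_extend_of_card_eq (α := Option (Option (Fin n)))
    (t := (Finset.univ : Finset ι)) (by simp [hcard])
    (s := {none, some none, some (some j₀), some (some j₁)}) (f := f) (Finset.subset_univ _) (by
      intro x hx y hy hxy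
      simp only [Finset.coe_insert, Finset.coe_singleton, Set.mem_insert_iff,
        Set.mem_singleton_iff] at hx hy
      rcases hx with rfl | rfl | rfl | rfl <;> rcases hy with rfl | rfl | rfl | rfl <;>
        simp_all [f, eq_comm])
  refine ⟨g.trans (Equiv.subtypeUnivEquiv Finset.mem_univ), ?_, ?_, ?_, ?_⟩
  · simpa [f] using hg none (by simp)
  · simpa [f] using hg (some none) (by simp)
  · simpa [f] using hg (some (some j₀)) (by simp)
  · simpa [f, hj.symm] using hg (some (some j₁)) (by simp)

lemma affineSpan_range_eq_top_of_isCircuit {d : ℕ} {ι : Type*} [Fintype ι] {v : ι → Fin d → ℝ}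
    {ρ : ι → ℝ} (h : IsCircuit v ρ) : affineSpan ℝ (Set.range v) = ⊤ := by
  rw [eq_top_iff]
  intro x _
  obtain ⟨c, hc1, rfl⟩ := h.span x 1
  rw [← Finset.affineCombination_eq_linear_combination _ _ _ hc1]
  exact affineCombination_mem_affineSpan hc1 v

/-- Affine lattice coordinates taking the listed vertices of `B⁽⁴⁾` to given points. -/
lemma image_polyB4 {M : ℕ} {G : (Fin (M + 3) → ℝ) ≃ᵃ[ℝ] (Fin (M + 3) → ℝ)}
    {o : Fin (M + 3) → ℝ} {w : Fin (M + 3) → Fin (M + 3) → ℝ}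
    (hG : ∀ y, G y = o + ∑ j, y j • w j) :
    G '' polyB4 (M + 3) = convexHull ℝ
      ({o, o + ∑ j : Fin (M + 1), w j.castSucc.castSucc + (2 : ℝ) • w (Fin.last (M + 2)),
        o - w 0 + w (Fin.last (M + 1)).castSucc} ∪
        Set.range fun j : Fin (M + 2) => o + w j.castSucc) := by
  rw [polyB4, ← AffineEquiv.coe_toAffineMap, AffineMap.image_convexHull,
    AffineEquiv.coe_toAffineMap, Set.image_union, Set.image_insert_eq, Set.image_insert_eq,
    Set.image_singleton]
  have h0 : G 0 = o := by simp [hG]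
  have h1 : G (fun j : Fin (M + 3) => if (j : ℕ) = M + 3 - 1 then (2 : ℝ)
      else if (j : ℕ) + 2 < M + 3 then 1 else 0) =
      o + ∑ j : Fin (M + 1), w j.castSucc.castSucc + (2 : ℝ) • w (Fin.last (M + 2)) := by
    rw [hG, Fin.sum_univ_castSucc, Fin.sum_univ_castSucc, ← add_assoc, ← add_assoc]
    have hs : ∀ j : Fin (M + 1), (if (j.castSucc.castSucc : ℕ) = M + 3 - 1 then (2 : ℝ)
        else if (j.castSucc.castSucc : ℕ) + 2 < M + 3 then 1 else 0) = 1 := by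
      intro j
      have := j.2
      simp only [Fin.val_castSucc]
      rw [if_neg (by omega), if_pos (by omega)]
    simp only [hs, one_smul]
    simp
  have h2 : G (fun j : Fin (M + 3) => if (j : ℕ) = 0 then (-1 : ℝ)
      else if (j : ℕ) = M + 3 - 2 then 1 else 0) =
      o - w 0 + w (Fin.last (M + 1)).castSucc := by
    rw [hG, Fin.sum_univ_castSucc, Fin.sum_univ_castSucc, Fin.sum_univ_succ]
    have hs : ∀ j : Fin M, (if (j.succ.castSucc.castSucc : ℕ) = 0 then (-1 : ℝ)
        else if (j.succ.castSucc.castSucc : ℕ) = M + 3 - 2 then 1 else 0) = 0 := by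
      intro j
      have := j.2
      simp only [Fin.val_castSucc, Fin.val_succ]
      rw [if_neg (by omega), if_neg (by omega)]
    simp only [hs, zero_smul]
    simp
    abel
  have h3 : ∀ j, G (stdE (M + 3) j) = o + w j := by
    intro j
    simp [hG, stdE]
  rw [h0, h1, h2]
  congr 2
  ext x
  constructor
  · rintro ⟨_, ⟨j, hj, rfl⟩, rfl⟩
    refine ⟨⟨j, hj⟩, ?_⟩
    rw [h3]
    rfl
  · rintro ⟨j, rfl⟩
    exact ⟨_, ⟨j.castSucc, j.2, rfl⟩, h3 _⟩

namespace IsCircuit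

lemma unimodEquiv_polyB4 {M k : ℕ} {ι : Type*} [Fintype ι] [DecidableEq ι]
    {v : ι → Fin (M + 3) → ℝ} {ρ g : ι → ℝ} (h : IsCircuit v ρ)
    (hcard : Fintype.card ι = M + 3 + 2) {p₀ p₁ q₀ q₁ : ι}
    (hp : p₀ ≠ p₁) (h₀₀ : p₀ ≠ q₀) (h₀₁ : p₀ ≠ q₁) (h₁₀ : p₁ ≠ q₀) (h₁₁ : p₁ ≠ q₁)
    (hq : q₀ ≠ q₁) (hρp₀ : ρ p₀ = 1) (hρp₁ : ρ p₁ = 1) (hρq₀ : ρ q₀ = -1) (hρq₁ : ρ q₁ = -1)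
    (hρ : ∀ i, i ≠ p₀ → i ≠ p₁ → i ≠ q₀ → i ≠ q₁ → ρ i = 0)
    (hgp₁ : g p₁ = 0) (hgq₀ : g q₀ = 1 / 2) (hgq₁ : g q₁ = 0)
    (hgr : ∀ i, i ≠ p₀ → i ≠ p₁ → i ≠ q₀ → i ≠ q₁ → g i = 1 / 2)
    (hsum : ∑ i, g i = k) (hg : g ∈ coeffLattice v)
    (hgen : ∀ b ∈ coeffLattice v, ∃ t : ℝ, b - t • ρ ∈ intTuples ι ∨ b - t • ρ - g ∈ intTuples ι) :
    UnimodEquiv (convexHull ℝ (Set.range v)) (polyB4 (M + 3)) := by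
  obtain ⟨σ, hσp₀, hσq₁, hσq₀, hσp₁⟩ := exists_enumeration (j₀ := 0)
    (j₁ := (Fin.last (M + 1)).castSucc) hcard (by simp [Fin.ext_iff]) hp h₀₀ h₀₁ h₁₀ h₁₁ hq
  set τ : Fin (M + 3) → ι := fun j => σ (some (some j)) with hτ
  have hcases : ∀ i, i = p₀ ∨ i = q₁ ∨ ∃ j, i = τ j := by
    intro i
    obtain ⟨x, rfl⟩ := σ.surjective i
    rcases x with _ | _ | j
    · exact Or.inl hσp₀
    · exact Or.inr (Or.inl hσq₁)
    · exact Or.inr (Or.inr ⟨j, rfl⟩)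
  have htotal : ∀ f : ι → Fin (M + 3) → ℝ, ∑ i, f i = f p₀ + (f q₁ + ∑ j, f (τ j)) := by
    intro f
    rw [← σ.sum_comp, Fintype.sum_option, Fintype.sum_option, hσp₀, hσq₁]
  have hgτ : ∀ j, j ≠ (Fin.last (M + 1)).castSucc → g (τ j) = 1 / 2 := by
    intro j hj
    by_cases hj0 : j = 0
    · rw [hj0]
      exact (congrArg g hσq₀).trans hgq₀
    · refine hgr _ ?_ ?_ ?_ ?_
      · rw [← hσp₀]; simp [hτ]
      · rw [← hσp₁]; simpa [hτ] using hj
      · rw [← hσq₀]; simpa [hτ] using hj0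
      · rw [← hσq₁]; simp [hτ]
  set a : ι → Fin (M + 3) → ℝ := fun i => v i - v p₀ with ha
  have hshift : ∀ c : ι → ℝ, ∑ i, c i • a i = ∑ i, c i • v i - (∑ i, c i) • v p₀ := by
    intro c
    simp [ha, smul_sub, Finset.sum_smul]
  have hap₀ : a p₀ = 0 := by simp [ha]
  have hρa : ∑ i, ρ i • a i = 0 := by rw [hshift, h.comb_zero, h.sum_zero]; simp
  have haq₁ : a q₁ = a p₁ - a q₀ := by
    have h1 : ∑ i, ρ i • a i = a p₁ - a q₀ - a q₁ := by
      have h2 : ∀ i, i ∉ ({p₀, p₁, q₀, q₁} : Finset ι) → ρ i • a i = 0 := by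
        intro i hi
        simp only [Finset.mem_insert, Finset.mem_singleton, not_or] at hi
        rw [hρ i hi.1 hi.2.1 hi.2.2.1 hi.2.2.2, zero_smul]
      rw [← Finset.sum_subset (Finset.subset_univ ({p₀, p₁, q₀, q₁} : Finset ι))
        fun i _ hi => h2 i hi]
      rw [Finset.sum_insert (by simp [hp, h₀₀, h₀₁]), Finset.sum_insert (by simp [h₁₀, h₁₁]),
        Finset.sum_insert (by simp [hq]), Finset.sum_singleton]
      simp only [hρp₀, hρp₁, hρq₀, hρq₁, hap₀, neg_smul, one_smul]
      abel
    rw [hρa] at h1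
    exact (sub_eq_zero.1 h1.symm).symm
  set S : Fin (M + 3) → ℝ := ∑ j : Fin (M + 1), a (τ j.castSucc.castSucc) with hS
  set γ : Fin (M + 3) → ℝ := ∑ i, g i • a i with hγ
  have hγ2 : (2 : ℝ) • γ = S + a (τ (Fin.last (M + 2))) := by
    rw [hγ, htotal, hap₀, hgq₁, Fin.sum_univ_castSucc, Fin.sum_univ_castSucc]
    have h1 : ∀ j : Fin (M + 1), g (τ j.castSucc.castSucc) = 1 / 2 :=
      fun j => hgτ _ (by simp)
    have h2 : g (τ (Fin.last (M + 1)).castSucc) = 0 := (congrArg g hσp₁).trans hgp₁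
    have h3 : g (τ (Fin.last (M + 2))) = 1 / 2 := hgτ _ (Fin.castSucc_lt_last _).ne'
    simp only [h1, h2, h3, ← Finset.smul_sum, ← hS]
    module
  let w : Fin (M + 3) → Fin (M + 3) → ℝ := Fin.snoc (fun j : Fin (M + 2) => a (τ j.castSucc)) (γ - S)
  have hwc : ∀ j : Fin (M + 2), w j.castSucc = a (τ j.castSucc) := fun j => by simp [w]
  have hwl : w (Fin.last (M + 2)) = γ - S := by simp [w]
  have haint : ∀ i, a i ∈ latticeSubgroup (M + 3) := fun i =>
    sub_mem (mem_latticeSubgroup.2 (h.int i)) (mem_latticeSubgroup.2 (h.int p₀))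
  have hγint : γ ∈ latticeSubgroup (M + 3) := by
    rw [hγ, hshift, hsum, Nat.cast_smul_eq_nsmul]
    exact sub_mem hg.2 (nsmul_mem (mem_latticeSubgroup.2 (h.int p₀)) k)
  have hmemc : ∀ j : Fin (M + 2), a (τ j.castSucc) ∈ Submodule.span ℤ (Set.range w) := fun j =>
    hwc j ▸ Submodule.subset_span ⟨_, rfl⟩
  have hmemS : S ∈ Submodule.span ℤ (Set.range w) := sum_mem fun j _ => hmemc _
  have hmemγ : γ ∈ Submodule.span ℤ (Set.range w) := by
    have : w (Fin.last (M + 2)) ∈ Submodule.span ℤ (Set.range w) := Submodule.subset_span ⟨_, rfl⟩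
    rw [hwl] at this
    simpa using add_mem this hmemS
  have hmema : ∀ i, a i ∈ Submodule.span ℤ (Set.range w) := by
    have hτmem : ∀ j, a (τ j) ∈ Submodule.span ℤ (Set.range w) := by
      intro j
      refine Fin.lastCases ?_ hmemc j
      have : a (τ (Fin.last (M + 2))) = γ + γ - S := by
        rw [← two_smul ℝ γ, hγ2]
        abel
      rw [this]
      exact sub_mem (add_mem hmemγ hmemγ) hmemS
    intro i
    rcases hcases i with rfl | rfl | ⟨j, rfl⟩
    · rw [hap₀]; exact zero_mem _
    · rw [haq₁, ← hσp₁, ← hσq₀]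
      exact sub_mem (hτmem _) (hτmem _)
    · exact hτmem j
  obtain ⟨G, hGlat, hG⟩ := exists_latticeEquiv (o := v p₀) (w := w) (h.int p₀) (by
      intro j
      refine Fin.lastCases ?_ (fun j => ?_) j
      · rw [hwl]
        exact sub_mem hγint (sum_mem fun j _ => haint _)
      · rw [hwc]
        exact haint _) (by
      intro x hx
      obtain ⟨c, hc1, hc2⟩ := h.span x 0
      have hxa : x = ∑ i, c i • a i := by rw [hshift, hc1, hc2]; simp
      have hint : ∀ m ∈ intTuples ι, ∑ i, m i • a i ∈ Submodule.span ℤ (Set.range w) := by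
        intro m hm
        refine sum_mem fun i _ => ?_
        obtain ⟨z, hz⟩ := mem_intTuples.1 hm i
        rw [hz, Int.cast_smul_eq_zsmul]
        exact Submodule.smul_mem _ z (hmema i)
      obtain ⟨t, ht | ht⟩ := hgen c ⟨⟨0, by simp [hc1]⟩, by rw [hc2]; exact hx⟩
      · have := hint _ ht
        simpa [sub_smul, mul_smul, ← Finset.smul_sum, hρa, ← hxa] using this
      · have := add_mem (hint _ ht) hmemγ
        simpa [sub_smul, mul_smul, ← Finset.smul_sum, hρa, ← hxa, ← hγ] using this)
  refine UnimodEquiv.of_affineEquiv G hGlat ?_ ?_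
  · rw [affineSpan_convexHull, affineSpan_range_eq_top_of_isCircuit h]
  · rw [image_polyB4 hG]
    have e1 : v p₀ + ∑ j : Fin (M + 1), w j.castSucc.castSucc + (2 : ℝ) • w (Fin.last (M + 2)) =
        v (τ (Fin.last (M + 2))) := by
      simp only [hwc, hwl, ← hS]
      rw [smul_sub, hγ2]
      simp only [ha]
      module
    have e2 : v p₀ - w 0 + w (Fin.last (M + 1)).castSucc = v q₁ := by
      have h1 := hwc 0
      rw [Fin.castSucc_zero] at h1
      have h2 : τ 0 = q₀ := hσq₀
      have h3 : τ (Fin.last (M + 1)).castSucc = p₁ := hσp₁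
      rw [h1, hwc, h2, h3]
      have h4 : v q₁ = v p₀ + a q₁ := by simp [ha]
      rw [h4, haq₁]
      abel
    have e3 : ∀ j : Fin (M + 2), v p₀ + w j.castSucc = v (τ j.castSucc) := by
      intro j
      simp [hwc, ha]
    simp only [e1, e2, e3]
    congr 1
    refine subset_antisymm ?_ ?_
    · rintro x ((rfl | rfl | rfl) | ⟨j, rfl⟩) <;> exact ⟨_, rfl⟩
    · rintro _ ⟨i, rfl⟩
      rcases hcases i with rfl | rfl | ⟨j, rfl⟩
      · simp
      · simp
      · refine Fin.lastCases (by simp) (fun j => Or.inr ⟨j, rfl⟩) j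

end IsCircuit

/-- a non-simplex, non-pyramid, non-spanning lattice polytope with
δ-polynomial `1 + t + 2t^k` has `d = 2k` and is unimodularly equivalent to `B⁽⁴⁾`. -/
theorem nonspanning_one_one_two_classification {d k : ℕ} (hk : 2 ≤ k)
    (P : Set (Fin d → ℝ)) (hP : IsLatticePolytope P) (hdim : affineSpan ℝ P = ⊤)
    (hns : ¬ IsSimplex P)
    (hδ : HasDeltaPoly P (1 + X + Polynomial.C 2 * X ^ k))
    (hspan : ¬ SpansLattice P) (hpyr : ¬ IsLatticePyramid P) :
    d = 2 * k ∧ UnimodEquiv P (polyB4 d) := by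
  have hcard := ncard_latticePts_of_deltaPoly hk hδ
  obtain ⟨v, lam, h, rfl, hrange⟩ := exists_isCircuit hP hdim hcard
  obtain ⟨c, hc, hcn⟩ := h.exists_nontrivial_class (subset_convexHull ℝ _) hspan
  obtain ⟨ρ, g, p₀, p₁, q₀, q₁, hρ, hp, h₀₀, h₀₁, h₁₀, h₁₁, hq, hρp₀, hρp₁, hρq₀, hρq₁, hρ0, hgp₀,
    hgp₁, hgq₀, hgq₁, hg2, hsum, hg, hgen⟩ := h.exists_parallelogram (by simp) hδ
      (h.two_le_card_pos hns) (h.two_le_card_neg hns) hc hcn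
  have hgr : ∀ i, i ≠ p₀ → i ≠ p₁ → i ≠ q₀ → i ≠ q₁ → g i = 1 / 2 := by
    intro r hr₁ hr₂ hr₃ hr₄
    refine (hg2 r).resolve_left fun hgr0 => hpyr ?_
    have hρr := hρ0 r hr₁ hr₂ hr₃ hr₄
    refine hρ.isLatticePyramid hr₁.symm hρr fun b hb => ?_
    obtain ⟨t, ht | ht⟩ := hgen b hb
    · simpa [hρr] using mem_intTuples.1 ht r
    · simpa [hρr, hgr0] using mem_intTuples.1 ht r
  have hd : d = 2 * k := by
    have h1 : ∑ i, (g i - 1 / 2) = ∑ i ∈ ({p₁, q₁} : Finset (Fin (d + 2))), (g i - 1 / 2) := by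
      refine (Finset.sum_subset (Finset.subset_univ _) fun i _ hi => ?_).symm
      simp only [Finset.mem_insert, Finset.mem_singleton, not_or] at hi
      by_cases hip : i = p₀
      · rw [hip, hgp₀, sub_self]
      by_cases hiq : i = q₀
      · rw [hiq, hgq₀, sub_self]
      rw [hgr i hip hi.1 hiq hi.2, sub_self]
    rw [Finset.sum_sub_distrib, hsum, Finset.sum_pair h₁₁, hgp₁, hgq₁] at h1
    simp at h1
    have h2 : (d : ℝ) = ((2 * k : ℕ) : ℝ) := by
      push_cast
      linarith
    exact_mod_cast h2
  refine ⟨hd, ?_⟩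
  obtain ⟨M, rfl⟩ : ∃ M, d = M + 3 := ⟨d - 3, by omega⟩
  exact hρ.unimodEquiv_polyB4 (by simp) hp h₀₀ h₀₁ h₁₀ h₁₁ hq hρp₀ hρp₁ hρq₀ hρq₁ hρ0 hgp₁ hgq₀
    hgq₁ hgr hsum hg hgen
end
end

section
/- Let k ≥ 1 and d = 2k − 1, and let Δ^(2) = conv{0, e_1, …, e_{d−1}, e_1 + ⋯ + e_{d−1} + 2e_d} ⊂ ℝ^d. Then Δ^(2) is a lattice simplex of dimension d whose δ-polynomial equals 1 + t^k (so Vol(Δ^(2)) = 2), Λ_{Δ^(2)} is the subgroup of (ℝ/ℤ)^{d+1} generated by (1/2, 1/2, …, 1/2), and Δ^(2) is not a lattice pyramid. -/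
open Pointwise Polynomial

noncomputable section

/-- The ordered vertices `0, e₁, …, e_{d−1}, e₁ + ⋯ + e_{d−1} + 2e_d` of `Δ⁽²⁾ ⊆ ℝ^d`. -/
def deltaTwoVerts (d : ℕ) : Fin (d + 1) → Fin d → ℝ := fun i j =>
  if (i : ℕ) = 0 then 0
  else if (i : ℕ) = d then (if (j : ℕ) = d - 1 then 2 else 1)
  else if (j : ℕ) + 1 = (i : ℕ) then 1 else 0

lemma deltaTwoVerts_apply {d : ℕ} (i : Fin (d + 1)) (j : Fin d) :
    deltaTwoVerts d i j = (if i = j.succ then 1 else 0) + (if i = Fin.last d then 1 else 0) := by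
  have hi := i.isLt
  have hj := j.isLt
  simp only [deltaTwoVerts, Fin.ext_iff, Fin.val_succ, Fin.val_last]
  split_ifs <;> first | omega | norm_num

lemma sum_mul_deltaTwoVerts {d : ℕ} (c : Fin (d + 1) → ℝ) (j : Fin d) :
    ∑ i, c i * deltaTwoVerts d i j = c j.succ + c (Fin.last d) := by
  simp [deltaTwoVerts_apply, mul_add, Finset.sum_add_distrib]

lemma exists_succ_eq_last {d : ℕ} (hd : 0 < d) : ∃ j : Fin d, j.succ = Fin.last d :=
  ⟨⟨d - 1, by omega⟩, by ext; simp; omega⟩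

lemma deltaTwoVerts_mem_latticePts {d : ℕ} (i : Fin (d + 1)) :
    deltaTwoVerts d i ∈ latticePts d := fun j =>
  ⟨(if i = j.succ then 1 else 0) + (if i = Fin.last d then 1 else 0), by
    rw [deltaTwoVerts_apply]; push_cast; rfl⟩

lemma eq_of_sum_eq_of_succ_add_last_eq {d : ℕ} (hd : 0 < d) {c c' : Fin (d + 1) → ℝ}
    (hsum : ∑ i, c i = ∑ i, c' i)
    (h : ∀ j : Fin d, c j.succ + c (Fin.last d) = c' j.succ + c' (Fin.last d)) : c = c' := by
  obtain ⟨l, hl⟩ := exists_succ_eq_last hd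
  have hlast : c (Fin.last d) = c' (Fin.last d) := by
    have := h l
    rw [hl] at this
    linarith
  have hsucc (j : Fin d) : c j.succ = c' j.succ := by linarith [h j]
  rw [Fin.sum_univ_succ, Fin.sum_univ_succ, Finset.sum_congr rfl fun j _ => hsucc j] at hsum
  funext i
  exact Fin.cases (by linarith) hsucc i

lemma affineIndependent_deltaTwoVerts {d : ℕ} (hd : 0 < d) :
    AffineIndependent ℝ (deltaTwoVerts d) := by
  rw [affineIndependent_iff_of_fintype]
  intro w hw hv
  rw [Finset.weightedVSub_eq_linear_combination _ hw] at hv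
  refine congrFun (eq_of_sum_eq_of_succ_add_last_eq (c' := 0) hd (by simpa using hw) fun j => ?_)
  have := congrFun hv j
  simp only [Finset.sum_apply, Pi.smul_apply, smul_eq_mul, sum_mul_deltaTwoVerts] at this
  simpa using this

lemma affineSpan_range_deltaTwoVerts {d : ℕ} (hd : 0 < d) :
    affineSpan ℝ (Set.range (deltaTwoVerts d)) = ⊤ := by
  rw [(affineIndependent_deltaTwoVerts hd).affineSpan_eq_top_iff_card_eq_finrank_add_one]
  simp

/-- Weights with integral total whose combination of the vertices is integral are either all
integers or all proper half-integers. -/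
lemma exists_eq_intCast_add_half {d k : ℕ} (hd : d + 1 = 2 * k)
    {c : Fin (d + 1) → ℝ}
    (h : ∀ j : Fin d, ∃ z : ℤ, c j.succ + c (Fin.last d) = z) (hsum : ∃ z : ℤ, ∑ i, c i = z) :
    ∃ e : ℕ, (e = 0 ∨ e = 1) ∧ ∀ i, ∃ z : ℤ, c i = z + (e : ℝ) / 2 := by
  choose z hz using h
  obtain ⟨s, hs⟩ := hsum
  obtain ⟨l, hl⟩ := exists_succ_eq_last (d := d) (by omega)
  have hzl := hz l
  rw [hl] at hzl
  obtain ⟨q, e, he, hq⟩ : ∃ (q : ℤ) (e : ℕ), (e = 0 ∨ e = 1) ∧ z l = 2 * q + e := by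
    rcases Int.even_or_odd' (z l) with ⟨q, h | h⟩
    · exact ⟨q, 0, by simp, by simpa using h⟩
    · exact ⟨q, 1, by simp, by simpa using h⟩
  have hq' : (z l : ℝ) = 2 * q + e := mod_cast hq
  have hlast : c (Fin.last d) = q + (e : ℝ) / 2 := by linarith
  have hsucc (j : Fin d) : c j.succ = ((z j - q - e : ℤ) : ℝ) + (e : ℝ) / 2 := by
    push_cast
    linarith [hz j]
  refine ⟨e, he, Fin.cases ⟨s - ∑ j, (z j - q - e) - k * e, ?_⟩ fun j => ⟨_, hsucc j⟩⟩
  rw [Fin.sum_univ_succ, Finset.sum_congr rfl fun j _ => hsucc j, Finset.sum_add_distrib,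
    Finset.sum_const, Finset.card_univ, Fintype.card_fin, nsmul_eq_mul] at hs
  have hd' : (d : ℝ) = 2 * k - 1 := by
    have : (d : ℝ) + 1 = 2 * k := mod_cast hd
    linarith
  rw [hd'] at hs
  push_cast at hs ⊢
  linarith

lemma simplexLambda_deltaTwoVerts {d k : ℕ} (hd : d + 1 = 2 * k) :
    simplexLambda (deltaTwoVerts d) =
      {(fun _ => (0 : ℝ) : Fin (d + 1) → ℝ), (fun _ => 1 / 2 : Fin (d + 1) → ℝ)} := by
  ext c
  simp only [simplexLambda, sum_mul_deltaTwoVerts, Set.mem_ofPred_eq, Set.mem_insert_iff,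
    Set.mem_singleton_iff]
  constructor
  · rintro ⟨hc, hint, hsum⟩
    obtain ⟨e, he, hz⟩ := exists_eq_intCast_add_half hd hint hsum
    have key (i) : c i = (e : ℝ) / 2 := by
      obtain ⟨z, hzi⟩ := hz i
      obtain ⟨h0, h1⟩ := hc i
      have he' : (e : ℝ) / 2 < 1 := by rcases he with rfl | rfl <;> norm_num
      have he0 : (0 : ℝ) ≤ (e : ℝ) / 2 := by positivity
      have hz0 : z = 0 := by
        have h2 : (z : ℝ) < 1 := by linarith
        have h3 : (-1 : ℝ) < z := by linarith
        have h2' : z < 1 := mod_cast h2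
        have h3' : -1 < z := mod_cast h3
        omega
      simpa [hz0] using hzi
    rcases he with rfl | rfl
    · left; funext i; simpa using key i
    · right; funext i; simpa using key i
  · rintro (rfl | rfl)
    · exact ⟨by simp, fun _ => ⟨0, by simp⟩, 0, by simp⟩
    · refine ⟨by norm_num, fun _ => ⟨1, by norm_num⟩, k, ?_⟩
      have : (d : ℝ) + 1 = 2 * k := mod_cast hd
      simp only [Finset.sum_const, Finset.card_univ, Fintype.card_fin, nsmul_eq_mul]
      push_cast
      linarith

lemma mem_convexHull_range_iff {ι E : Type*} [Fintype ι] [AddCommGroup E] [Module ℝ E]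
    {v : ι → E} {x : E} :
    x ∈ convexHull ℝ (Set.range v) ↔
      ∃ w : ι → ℝ, (∀ i, 0 ≤ w i) ∧ ∑ i, w i = 1 ∧ ∑ i, w i • v i = x := by
  classical
  constructor
  · intro hx
    refine convexHull_min (t := {x | ∃ w : ι → ℝ, (∀ i, 0 ≤ w i) ∧ ∑ i, w i = 1 ∧
      ∑ i, w i • v i = x}) ?_ ?_ hx
    · rintro _ ⟨i, rfl⟩
      exact ⟨Pi.single i 1, fun j => by by_cases h : j = i <;> simp [h],
        by simp, by simp [Pi.single_apply]⟩
    · rintro _ ⟨w, hw, hw1, rfl⟩ _ ⟨w', hw', hw1', rfl⟩ a b ha hb hab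
      refine ⟨a • w + b • w', fun i => ?_, ?_, ?_⟩
      · have := hw i
        have := hw' i
        simp only [Pi.add_apply, Pi.smul_apply, smul_eq_mul]
        positivity
      · simp [Finset.sum_add_distrib, ← Finset.mul_sum, hw1, hw1', hab]
      · simp [Finset.sum_add_distrib, add_smul, mul_smul, Finset.smul_sum]
  · rintro ⟨w, hw, hw1, hx⟩
    exact mem_convexHull_of_exists_fintype w v hw hw1 (fun i => ⟨i, rfl⟩) hx

lemma mem_smul_convexHull_deltaTwoVerts_iff {d n : ℕ} (hn : n ≠ 0) {x : Fin d → ℝ} :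
    x ∈ (n : ℝ) • convexHull ℝ (Set.range (deltaTwoVerts d)) ↔
      ∃ w : Fin (d + 1) → ℝ, (∀ i, 0 ≤ w i) ∧ ∑ i, w i = n ∧
        ∀ j, w j.succ + w (Fin.last d) = x j := by
  have hn' : (n : ℝ) ≠ 0 := mod_cast hn
  simp only [Set.mem_smul_set, mem_convexHull_range_iff]
  constructor
  · rintro ⟨_, ⟨w, hw, hw1, rfl⟩, rfl⟩
    refine ⟨(n : ℝ) • w, fun i => mul_nonneg (by positivity) (hw i), ?_, fun j => ?_⟩
    · simp [← Finset.mul_sum, hw1]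
    · simp [Finset.sum_apply, sum_mul_deltaTwoVerts, mul_add]
  · rintro ⟨w, hw, hw1, hx⟩
    refine ⟨(n : ℝ)⁻¹ • x, ⟨(n : ℝ)⁻¹ • w, fun i => mul_nonneg (by positivity) (hw i), ?_, ?_⟩,
      smul_inv_smul₀ hn' x⟩
    · simp [← Finset.mul_sum, hw1, hn']
    · funext j
      simp only [Finset.sum_apply, Pi.smul_apply, smul_eq_mul, sum_mul_deltaTwoVerts, ← hx j]
      ring

lemma card_piAntidiag_univ_fin (d n : ℕ) :
    (Finset.piAntidiag (Finset.univ : Finset (Fin (d + 1))) n).card = (d + n).choose d := by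
  rw [← Finset.map_sym_eq_piAntidiag, Finset.card_map, Finset.sym_univ, Finset.card_univ,
    Sym.card_sym_eq_choose, Fintype.card_fin, show d + 1 + n - 1 = d + n by omega,
    Nat.choose_symm_add]

/-- The combination of the vertices of `Δ⁽²⁾` with weights `a i + e / 2`. -/
def latticeComb (d e : ℕ) (a : Fin (d + 1) → ℕ) : Fin d → ℝ :=
  fun j => (a j.succ : ℝ) + a (Fin.last d) + e

lemma latticePts_inter_smul_eq {d k n : ℕ} (hd : d + 1 = 2 * k) (hn : n ≠ 0) :
    latticePts d ∩ (n : ℝ) • convexHull ℝ (Set.range (deltaTwoVerts d)) =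
      latticeComb d 0 '' {a | ∑ i, a i = n} ∪ latticeComb d 1 '' {a | ∑ i, a i + k = n} := by
  have hdk : (d : ℝ) + 1 = 2 * k := mod_cast hd
  ext x
  rw [Set.mem_inter_iff, mem_smul_convexHull_deltaTwoVerts_iff hn]
  constructor
  · rintro ⟨hx, w, hw, hsum, hwx⟩
    obtain ⟨e, he, hz⟩ := exists_eq_intCast_add_half hd (c := w)
      (fun j => by rw [hwx j]; exact hx j) ⟨n, by simpa using hsum⟩
    choose z hz using hz
    have hz0 (i) : 0 ≤ z i := by
      have h1 := hw i
      have he' : (e : ℝ) / 2 < 1 := by rcases he with rfl | rfl <;> norm_num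
      have h3 : (-1 : ℝ) < z i := by linarith [hz i]
      have h3' : -1 < z i := mod_cast h3
      omega
    lift z to Fin (d + 1) → ℕ using hz0
    have hxe : latticeComb d e z = x := by
      funext j
      rw [← hwx j, hz, hz, latticeComb]
      push_cast
      ring
    have hsum' : (∑ i, (z i : ℝ)) + k * e = n := by
      rw [← hsum, Finset.sum_congr rfl fun i _ => hz i, Finset.sum_add_distrib]
      simp only [Finset.sum_const, Finset.card_univ, Fintype.card_fin, nsmul_eq_mul]
      push_cast
      rw [hdk]
      ring
    have hsum'' : (∑ i, z i) + k * e = n := mod_cast hsum'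
    rcases he with rfl | rfl
    · exact Or.inl ⟨z, by simpa using hsum'', hxe⟩
    · exact Or.inr ⟨z, by simpa using hsum'', hxe⟩
  · have aux (e : ℕ) (a : Fin (d + 1) → ℕ) (ha : ∑ i, a i + k * e = n) :
        latticeComb d e a ∈ latticePts d ∧ ∃ w : Fin (d + 1) → ℝ, (∀ i, 0 ≤ w i) ∧
          ∑ i, w i = n ∧ ∀ j, w j.succ + w (Fin.last d) = latticeComb d e a j := by
      refine ⟨fun j => ⟨a j.succ + a (Fin.last d) + e, by simp [latticeComb]⟩,
        fun i => a i + (e : ℝ) / 2, fun i => by positivity, ?_, fun j => ?_⟩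
      · rw [Finset.sum_add_distrib, ← ha]
        simp only [Finset.sum_const, Finset.card_univ, Fintype.card_fin, nsmul_eq_mul]
        push_cast
        rw [hdk]
        ring
      · simp only [latticeComb]
        ring
    rintro (⟨a, ha, rfl⟩ | ⟨a, ha, rfl⟩)
    · exact aux 0 a (by simpa using ha)
    · exact aux 1 a (by simpa using ha)

lemma latticeComb_injOn {d e k n : ℕ} (hd : 0 < d) :
    Set.InjOn (latticeComb d e) {a | ∑ i, a i + k = n} := by
  intro a ha b hb hab
  have hsum : ∑ i, a i = ∑ i, b i := by
    simp only [Set.mem_ofPred_eq] at ha hb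
    omega
  have := eq_of_sum_eq_of_succ_add_last_eq (c := fun i => (a i : ℝ)) (c' := fun i => (b i : ℝ)) hd
    (mod_cast hsum) fun j => by
      have := congrFun hab j
      simp only [latticeComb] at this
      linarith
  funext i
  exact_mod_cast congrFun this i

lemma setOf_sum_add_eq {d k n : ℕ} : {a : Fin (d + 1) → ℕ | ∑ i, a i + k = n} =
    if k ≤ n then ↑(Finset.piAntidiag (Finset.univ : Finset (Fin (d + 1))) (n - k)) else ∅ := by
  ext a
  split_ifs with h
  · simp only [Set.mem_ofPred_eq, Finset.mem_coe, Finset.mem_piAntidiag, Finset.mem_univ,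
      implies_true, and_true]
    change ∑ i, a i + k = n ↔ ∑ i, a i = n - k
    omega
  · simp only [Set.mem_ofPred_eq, Set.mem_empty_iff_false, iff_false]
    omega

lemma ehrhartCount_deltaTwo {d k n : ℕ} (hd : d + 1 = 2 * k) (hn : n ≠ 0) :
    ehrhartCount (convexHull ℝ (Set.range (deltaTwoVerts d))) n =
      (d + n).choose d + if k ≤ n then (d + (n - k)).choose d else 0 := by
  have hd0 : 0 < d := by omega
  have hcard (l : ℕ) : {a : Fin (d + 1) → ℕ | ∑ i, a i + l = n}.ncard =
      if l ≤ n then (d + (n - l)).choose d else 0 := by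
    rw [setOf_sum_add_eq]
    split_ifs
    · rw [Set.ncard_coe_finset, card_piAntidiag_univ_fin]
    · simp
  have hfin (l : ℕ) : {a : Fin (d + 1) → ℕ | ∑ i, a i + l = n}.Finite := by
    rw [setOf_sum_add_eq]
    split_ifs
    · exact Finset.finite_toSet _
    · exact Set.finite_empty
  have hdisj : Disjoint (latticeComb d 0 '' {a | ∑ i, a i + 0 = n})
      (latticeComb d 1 '' {a | ∑ i, a i + k = n}) := by
    rw [Set.disjoint_left]
    rintro _ ⟨a, -, rfl⟩ ⟨b, -, hab⟩
    obtain ⟨l, hl⟩ := exists_succ_eq_last hd0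
    have := congrFun hab l
    simp only [latticeComb, hl] at this
    norm_cast at this
    omega
  have h := latticePts_inter_smul_eq hd hn
  rw [ehrhartCount, h]
  change (latticeComb d 0 '' {a | ∑ i, a i + 0 = n} ∪ _).ncard = _
  rw [Set.ncard_union_eq hdisj ((hfin 0).image _) ((hfin k).image _),
    (latticeComb_injOn hd0).ncard_image,
    (latticeComb_injOn hd0).ncard_image, hcard, hcard]
  simp

lemma hasDeltaPoly_deltaTwo {d k : ℕ} (hd : d + 1 = 2 * k) :
    HasDeltaPoly (convexHull ℝ (Set.range (deltaTwoVerts d))) (1 + X ^ k) := by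
  have h : ehrhartSeries (convexHull ℝ (Set.range (deltaTwoVerts d))) =
      (1 + PowerSeries.X ^ k) * PowerSeries.mk fun n => ((d + n).choose d : ℤ) := by
    ext n
    rw [add_mul, one_mul, map_add, PowerSeries.coeff_X_pow_mul', ehrhartSeries,
      PowerSeries.coeff_mk, PowerSeries.coeff_mk, PowerSeries.coeff_mk]
    split_ifs with h0 hkn hkn
    · omega
    · simp [h0]
    · simp [ehrhartCount_deltaTwo hd h0, hkn]
    · simp [ehrhartCount_deltaTwo hd h0, hkn]
  rw [HasDeltaPoly, h, mul_left_comm, mul_comm ((1 - PowerSeries.X) ^ (d + 1)),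
    PowerSeries.mk_add_choose_mul_one_sub_pow_eq_one]
  simp

/-- In a lattice pyramid the last coordinate lies in `[0, 1]`, and only the apex has last
coordinate `1`. -/
lemma pyramidOver_subset {e : ℕ} (Q : Set (Fin e → ℝ)) :
    pyramidOver Q ⊆ {y | (0 ≤ y (Fin.last e) ∧ y (Fin.last e) < 1) ∨
      y = Fin.snoc (0 : Fin e → ℝ) (1 : ℝ)} := by
  have hlast : (Fin.snoc (0 : Fin e → ℝ) (1 : ℝ) : Fin (e + 1) → ℝ) (Fin.last e) = 1 :=
    Fin.snoc_last ..
  refine convexHull_min ?_ ?_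
  · rintro y (⟨x, -, rfl⟩ | rfl)
    · exact Or.inl (by simp)
    · exact Or.inr rfl
  · refine convex_iff_forall_pos.2 fun x hx y hy a b ha hb hab => ?_
    simp only [Set.mem_ofPred_eq, Pi.add_apply, Pi.smul_apply, smul_eq_mul] at hx hy ⊢
    rcases hx with ⟨hx0, hx1⟩ | rfl <;> rcases hy with ⟨hy0, hy1⟩ | rfl
    · exact Or.inl ⟨by positivity, by nlinarith⟩
    · rw [hlast]
      exact Or.inl ⟨by positivity, by nlinarith⟩
    · rw [hlast]
      exact Or.inl ⟨by positivity, by nlinarith⟩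
    · right
      rw [← add_smul, hab, one_smul]

lemma not_isLatticePyramid_deltaTwo {d k : ℕ} (hd : d + 1 = 2 * k) :
    ¬ IsLatticePyramid (convexHull ℝ (Set.range (deltaTwoVerts d))) := by
  rintro ⟨e, Q, -, -, f, hf, hfP⟩
  have hd0 : 0 < d := by omega
  have hdk : (d : ℝ) + 1 = 2 * k := mod_cast hd
  rw [affineSpan_convexHull, affineSpan_range_deltaTwoVerts hd0, AffineSubspace.top_coe,
    Set.inter_univ] at hf
  have hint (x) (hx : x ∈ latticePts d) : ∃ z : ℤ, f x (Fin.last e) = z := (hf.mapsTo hx).1 _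
  have hmem (i) : f (deltaTwoVerts d i) ∈ pyramidOver Q :=
    hfP ▸ Set.mem_image_of_mem f (subset_convexHull ℝ _ ⟨i, rfl⟩)
  have hvert (i) : f (deltaTwoVerts d i) (Fin.last e) = 0 ∨
      f (deltaTwoVerts d i) = Fin.snoc (0 : Fin e → ℝ) (1 : ℝ) := by
    rcases pyramidOver_subset Q (hmem i) with ⟨h0, h1⟩ | h
    · left
      obtain ⟨z, hz⟩ := hint _ (deltaTwoVerts_mem_latticePts i)
      rw [hz] at h0 h1 ⊢
      have h0' : 0 ≤ z := mod_cast h0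
      have h1' : z < 1 := mod_cast h1
      have : z = 0 := by omega
      simp [this]
    · exact Or.inr h
  have hcomb (w : Fin (d + 1) → ℝ) :
      f (∑ i, w i • deltaTwoVerts d i) (Fin.last e) =
        ∑ i, w i * f (deltaTwoVerts d i) (Fin.last e)
          + (1 - ∑ i, w i) * f 0 (Fin.last e) := by
    have hlin (x) : f x = f.linear x + f 0 := by simpa using f.map_vadd 0 x
    simp only [hlin (∑ i, w i • deltaTwoVerts d i), hlin (deltaTwoVerts d _), map_sum, map_smul,
      Pi.add_apply, Finset.sum_apply, Pi.smul_apply, smul_eq_mul, mul_add,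
      Finset.sum_add_distrib, ← Finset.sum_mul]
    ring
  obtain ⟨i₀, hi₀⟩ : ∃ i, f (deltaTwoVerts d i) = Fin.snoc (0 : Fin e → ℝ) (1 : ℝ) := by
    by_contra! hne
    have hapex : (Fin.snoc (0 : Fin e → ℝ) (1 : ℝ) : Fin (e + 1) → ℝ) ∈ pyramidOver Q :=
      subset_convexHull ℝ _ (Or.inr rfl)
    rw [← hfP] at hapex
    obtain ⟨x, hx, hfx⟩ := hapex
    obtain ⟨w, -, hw1, rfl⟩ := mem_convexHull_range_iff.1 hx
    have h := hcomb w
    rw [hfx, hw1, Finset.sum_eq_zero fun i _ => by rw [(hvert i).resolve_right (hne i), mul_zero]]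
      at h
    simp at h
  have hother (i) (hi : i ≠ i₀) : f (deltaTwoVerts d i) (Fin.last e) = 0 := by
    refine (hvert i).resolve_right fun h => hi ?_
    exact (affineIndependent_deltaTwoVerts hd0).injective
      (hf.injOn (deltaTwoVerts_mem_latticePts i) (deltaTwoVerts_mem_latticePts i₀)
        (h.trans hi₀.symm))
  have hlat : (∑ i, (1 / 2 : ℝ) • deltaTwoVerts d i) ∈ latticePts d := fun j => ⟨1, by
    simp only [Finset.sum_apply, Pi.smul_apply, smul_eq_mul]
    rw [sum_mul_deltaTwoVerts (fun _ => 1 / 2) j]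
    norm_num⟩
  obtain ⟨a, ha⟩ := hint _ hlat
  obtain ⟨b, hb⟩ := hint 0 fun _ => ⟨0, by simp⟩
  have h := hcomb fun _ => 1 / 2
  rw [ha, hb, Finset.sum_eq_single i₀ (fun i _ hi => by rw [hother i hi, mul_zero]) (by simp),
    hi₀, Fin.snoc_last] at h
  simp only [Finset.sum_const, Finset.card_univ, Fintype.card_fin, nsmul_eq_mul] at h
  push_cast at h
  rw [hdk] at h
  have h' : (2 * a : ℝ) = 1 + 2 * ((1 - k) * b) := by linarith
  have h'' : 2 * a = 1 + 2 * ((1 - k) * b) := mod_cast h'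
  omega

/-- `Δ⁽²⁾` is a non-pyramid lattice simplex of dimension `d = 2k − 1` with
δ-polynomial `1 + t^k` and `Λ_{Δ⁽²⁾} = ⟨(1/2, …, 1/2)⟩`. -/
theorem deltaTwoSimplex_properties (k : ℕ) (hk : 1 ≤ k) (d : ℕ) (hd : d = 2 * k - 1) :
    AffineIndependent ℝ (deltaTwoVerts d) ∧
    (∀ i, deltaTwoVerts d i ∈ latticePts d) ∧
    affineSpan ℝ (Set.range (deltaTwoVerts d)) = ⊤ ∧
    HasDeltaPoly (convexHull ℝ (Set.range (deltaTwoVerts d))) (1 + X ^ k) ∧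
    ((1 + X ^ k : Polynomial ℤ).eval 1 = 2) ∧
    simplexLambda (deltaTwoVerts d) =
      {(fun _ => (0 : ℝ) : Fin (d + 1) → ℝ), (fun _ => 1 / 2 : Fin (d + 1) → ℝ)} ∧
    ¬ IsLatticePyramid (convexHull ℝ (Set.range (deltaTwoVerts d))) := by
  have hd' : d + 1 = 2 * k := by omega
  have hd0 : 0 < d := by omega
  exact ⟨affineIndependent_deltaTwoVerts hd0, deltaTwoVerts_mem_latticePts,
    affineSpan_range_deltaTwoVerts hd0, hasDeltaPoly_deltaTwo hd', by norm_num,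
    simplexLambda_deltaTwoVerts hd', not_isLatticePyramid_deltaTwo hd'⟩
end
end

section
/- Let 1 ≤ i_1 ≤ i_2 be integers with 2i_1 ≥ i_2, set d = i_1 + i_2 − 1, and let Δ^(3) = conv{0, e_1, …, e_{d−1}, w} ⊂ ℝ^d where w = 2·Σ_{i=1, i≠d}^{−i_1+2i_2−1} e_i + Σ_{i=−i_1+2i_2}^{d−1} e_i + 3e_d. Then Δ^(3) is a lattice simplex of dimension d whose δ-polynomial equals 1 + t^{i_1} + t^{i_2} (so Vol(Δ^(3)) = 3), and Δ^(3) is not a lattice pyramid. -/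
open Pointwise Polynomial

noncomputable section

/-- The simplex `Δ⁽³⁾ = conv{0, e₁, …, e_{d−1}, w}` with
`w = 2·Σ_{i=1, i≠d}^{−i₁+2i₂−1} eᵢ + Σ_{i=−i₁+2i₂}^{d−1} eᵢ + 3e_d`. -/
def deltaThreeSimplex (d i1 i2 : ℕ) : Set (Fin d → ℝ) :=
  convexHull ℝ
    ({0, fun j : Fin d =>
        if (j : ℕ) = d - 1 then (3 : ℝ)
        else if (j : ℕ) + i1 + 2 ≤ 2 * i2 then 2 else 1} ∪
      {x | ∃ j : Fin d, (j : ℕ) < d - 1 ∧ x = stdE d j})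

/-- The integers as a subring of `ℝ`. -/
def integerSubring : Subring ℝ := (Int.castRingHom ℝ).range

lemma mem_integerSubring {x : ℝ} : x ∈ integerSubring ↔ ∃ z : ℤ, x = z := by
  simp [integerSubring, RingHom.mem_range, eq_comm]

lemma natCast_mem_integerSubring (n : ℕ) : (n : ℝ) ∈ integerSubring :=
  mem_integerSubring.2 ⟨n, by simp⟩

lemma eq_of_sub_mem_integerSubring {x y : ℝ} (hx : 0 ≤ x ∧ x < 1) (hy : 0 ≤ y ∧ y < 1)
    (h : x - y ∈ integerSubring) : x = y := by
  obtain ⟨z, hz⟩ := mem_integerSubring.1 h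
  have h1 : (z : ℝ) < 1 := by linarith [hx.2, hy.1]
  have h2 : (-1 : ℝ) < z := by linarith [hx.1, hy.2]
  have h3 : z < 1 := by exact_mod_cast h1
  have h4 : -1 < z := by exact_mod_cast h2
  have h5 : z = 0 := by omega
  rw [h5, Int.cast_zero] at hz
  linarith

lemma mem_latticePts {d : ℕ} {x : Fin d → ℝ} :
    x ∈ latticePts d ↔ ∀ i, x i ∈ integerSubring := by
  simp [latticePts, mem_integerSubring]

lemma mem_simplexLambda {d : ℕ} {v : Fin (d + 1) → Fin d → ℝ} {c : Fin (d + 1) → ℝ} :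
    c ∈ simplexLambda v ↔ (∀ i, 0 ≤ c i ∧ c i < 1) ∧
      (∑ i, c i • v i) ∈ latticePts d ∧ (∑ i, c i) ∈ integerSubring := by
  simp [simplexLambda, latticePts, mem_integerSubring]

lemma sum_smul_mem_latticePts {d : ℕ} {ι : Type*} [Fintype ι] {v : ι → Fin d → ℝ}
    (hv : ∀ i, v i ∈ latticePts d) {c : ι → ℝ} (hc : ∀ i, c i ∈ integerSubring) :
    (∑ i, c i • v i) ∈ latticePts d := by
  refine mem_latticePts.2 fun j => ?_
  rw [Finset.sum_apply]
  exact sum_mem fun i _ => mul_mem (hc i) (mem_latticePts.1 (hv i) j)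

lemma mem_smul_convexHull_range {d : ℕ} {ι : Type} [Fintype ι] [Nonempty ι]
    (v : ι → Fin d → ℝ) {t : ℝ} (ht : 0 ≤ t) {x : Fin d → ℝ} :
    x ∈ t • convexHull ℝ (Set.range v) ↔
      ∃ c : ι → ℝ, (∀ i, 0 ≤ c i) ∧ ∑ i, c i = t ∧ ∑ i, c i • v i = x := by
  constructor
  · rintro ⟨p, hp, rfl⟩
    rw [convexHull_range_eq_exists_affineCombination] at hp
    obtain ⟨s, w, hw0, hw1, rfl⟩ := hp
    classical
    refine ⟨fun i => if i ∈ s then t * w i else 0, fun i => ?_, ?_, ?_⟩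
    · dsimp only
      split_ifs with h
      · exact mul_nonneg ht (hw0 i h)
      · exact le_rfl
    · rw [Finset.sum_ite_mem, Finset.univ_inter, ← Finset.mul_sum, hw1, mul_one]
    · simp only [ite_smul, zero_smul]
      rw [Finset.sum_ite_mem, Finset.univ_inter,
        Finset.affineCombination_eq_linear_combination s v w hw1]
      simp [Finset.smul_sum, mul_smul]
  · rintro ⟨c, hc0, hc1, rfl⟩
    rcases ht.eq_or_lt with rfl | ht
    · have hc : ∀ i, c i = 0 := fun i =>
        (Finset.sum_eq_zero_iff_of_nonneg fun i _ => hc0 i).1 hc1 i (Finset.mem_univ i)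
      obtain ⟨i⟩ := ‹Nonempty ι›
      exact ⟨v i, subset_convexHull ℝ _ ⟨i, rfl⟩, by simp [hc]⟩
    · refine ⟨∑ i, (t⁻¹ * c i) • v i, mem_convexHull_of_exists_fintype (fun i => t⁻¹ * c i) v
        (fun i => mul_nonneg (inv_nonneg.2 ht.le) (hc0 i)) ?_ (fun i => ⟨i, rfl⟩) rfl, ?_⟩
      · rw [← Finset.mul_sum, hc1, inv_mul_cancel₀ ht.ne']
      · simp only [Finset.smul_sum, smul_smul]
        simp [ht.ne']

lemma AffineIndependent.eq_of_sum_smul_eq {d : ℕ} {ι : Type*} [Fintype ι] {v : ι → Fin d → ℝ}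
    (hv : AffineIndependent ℝ v) {a b : ι → ℝ} (h1 : ∑ i, a i = ∑ i, b i)
    (h2 : ∑ i, a i • v i = ∑ i, b i • v i) : a = b := by
  funext i
  have := affineIndependent_iff.1 hv Finset.univ (fun i => a i - b i)
    (by simp [Finset.sum_sub_distrib, h1]) (by simp [sub_smul, Finset.sum_sub_distrib, h2]) i
    (Finset.mem_univ i)
  exact sub_eq_zero.1 this

lemma coeff_mk_one_pow_eq_card_finsuppAntidiag (k n : ℕ) :
    PowerSeries.coeff n ((PowerSeries.mk 1 : PowerSeries ℤ) ^ k) =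
      ((Finset.univ : Finset (Fin k)).finsuppAntidiag n).card := by
  have h := PowerSeries.coeff_prod (R := ℤ) (fun _ : Fin k => PowerSeries.mk 1) n Finset.univ
  simpa using h

/-- The number of lattice points in the dilates of a lattice simplex, in terms of `Λ_Δ`. -/
lemma ehrhartCount_eq_card {d : ℕ} {v : Fin (d + 1) → Fin d → ℝ}
    (hv : AffineIndependent ℝ v) (hlat : ∀ i, v i ∈ latticePts d)
    {ι : Type} [Fintype ι] {f : ι → Fin (d + 1) → ℝ} (hinj : Function.Injective f)
    (hrange : Set.range f = simplexLambda v) {ht : ι → ℕ} (hht : ∀ r, ∑ i, f r i = ht r) (n : ℕ) :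
    ehrhartCount (convexHull ℝ (Set.range v)) n =
      ∑ r, if ht r ≤ n then
        ((Finset.univ : Finset (Fin (d + 1))).finsuppAntidiag (n - ht r)).card else 0 := by
  classical
  have hmem : ∀ r, f r ∈ simplexLambda v := fun r => hrange ▸ ⟨r, rfl⟩
  let T : Finset (Σ _ : ι, Fin (d + 1) →₀ ℕ) := Finset.univ.sigma fun r =>
    if ht r ≤ n then (Finset.univ : Finset (Fin (d + 1))).finsuppAntidiag (n - ht r) else ∅
  have hT : ∀ p : Σ _ : ι, Fin (d + 1) →₀ ℕ, p ∈ T ↔ ht p.1 + ∑ i, p.2 i = n := by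
    rintro ⟨r, m⟩
    simp only [T, Finset.mem_sigma, Finset.mem_univ, true_and]
    split_ifs with h
    · rw [Finset.mem_finsuppAntidiag, and_iff_left (Finset.subset_univ _)]
      exact ⟨fun h' => by rw [h']; omega, fun h' => by rw [← h', Nat.add_sub_cancel_left]⟩
    · simp only [Finset.notMem_empty, false_iff]
      omega
  have hTsum : ∀ p ∈ T, ∑ i, (f p.1 i + (p.2 i : ℝ)) = n := fun p hp => by
    rw [Finset.sum_add_distrib, hht, ← (hT p).1 hp]
    push_cast
    rfl
  let φ : (Σ _ : ι, Fin (d + 1) →₀ ℕ) → Fin d → ℝ := fun p =>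
    ∑ i, (f p.1 i + (p.2 i : ℝ)) • v i
  have hφ : Set.InjOn φ T := by
    rintro ⟨r, m⟩ hp ⟨r', m'⟩ hp' h
    have h1 := hv.eq_of_sum_smul_eq ((hTsum _ hp).trans (hTsum _ hp').symm) h
    have h2 : f r = f r' := by
      funext i
      refine eq_of_sub_mem_integerSubring ((mem_simplexLambda.1 (hmem r)).1 i)
        ((mem_simplexLambda.1 (hmem r')).1 i) ?_
      have h3 : f r i - f r' i = (m' i : ℝ) - m i := by
        have := congrFun h1 i
        dsimp only at this
        linarith
      rw [h3]
      exact sub_mem (natCast_mem_integerSubring _) (natCast_mem_integerSubring _)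
    obtain rfl := hinj h2
    congr 1
    ext i
    simpa using congrFun h1 i
  have himage : latticePts d ∩ (n : ℝ) • convexHull ℝ (Set.range v) = φ '' T := by
    ext x
    rw [Set.mem_inter_iff, mem_smul_convexHull_range v n.cast_nonneg]
    constructor
    · rintro ⟨hx, c, hc0, hc1, rfl⟩
      have hsplit : ∀ i, c i = Int.fract (c i) + (⌊c i⌋₊ : ℝ) := fun i => by
        rw [natCast_floor_eq_intCast_floor (hc0 i)]
        exact (Int.fract_add_floor _).symm
      have hfract : ∀ i, Int.fract (c i) = c i - (⌊c i⌋₊ : ℝ) := fun i => by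
        linarith [hsplit i]
      have hΛ : (fun i => Int.fract (c i)) ∈ simplexLambda v := by
        refine mem_simplexLambda.2
          ⟨fun i => ⟨Int.fract_nonneg _, Int.fract_lt_one _⟩, ?_, ?_⟩
        · simp only [hfract, sub_smul, Finset.sum_sub_distrib]
          have := sum_smul_mem_latticePts hlat fun i => natCast_mem_integerSubring ⌊c i⌋₊
          exact mem_latticePts.2 fun j =>
            sub_mem (mem_latticePts.1 hx j) (mem_latticePts.1 this j)
        · simp only [hfract, Finset.sum_sub_distrib, hc1]
          exact sub_mem (natCast_mem_integerSubring _)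
            (sum_mem fun i _ => natCast_mem_integerSubring _)
      rw [← hrange] at hΛ
      obtain ⟨r, hr⟩ := hΛ
      refine ⟨⟨r, Finsupp.equivFunOnFinite.symm fun i => ⌊c i⌋₊⟩, (hT _).2 ?_, ?_⟩
      · have : ((ht r + ∑ i, ⌊c i⌋₊ : ℕ) : ℝ) = n := by
          push_cast
          rw [← hht, ← hc1, ← Finset.sum_add_distrib]
          exact Finset.sum_congr rfl fun i _ => by rw [hr]; exact (hsplit i).symm
        exact_mod_cast this
      · exact Finset.sum_congr rfl fun i _ => by
          simp only [hr, Finsupp.equivFunOnFinite_symm_apply_apply]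
          rw [← hsplit i]
    · rintro ⟨p, hp, rfl⟩
      refine ⟨?_, _, fun i => add_nonneg ((mem_simplexLambda.1 (hmem p.1)).1 i).1
        (Nat.cast_nonneg _), hTsum p hp, rfl⟩
      have h1 := (mem_simplexLambda.1 (hmem p.1)).2.1
      have h2 := sum_smul_mem_latticePts hlat fun i => natCast_mem_integerSubring (p.2 i)
      refine mem_latticePts.2 fun j => ?_
      simp only [φ, add_smul, Finset.sum_add_distrib]
      exact add_mem (mem_latticePts.1 h1 j) (mem_latticePts.1 h2 j)
  rw [ehrhartCount, himage, hφ.ncard_image, Set.ncard_coe_finset, Finset.card_sigma]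
  exact Finset.sum_congr rfl fun r _ => by split_ifs <;> simp

/-- The δ-polynomial of a lattice simplex is the generating function of the heights of the
elements of `Λ_Δ`. -/
theorem hasDeltaPoly_convexHull_range {d : ℕ} {v : Fin (d + 1) → Fin d → ℝ}
    (hv : AffineIndependent ℝ v) (hlat : ∀ i, v i ∈ latticePts d)
    {ι : Type} [Fintype ι] {f : ι → Fin (d + 1) → ℝ} (hinj : Function.Injective f)
    (hrange : Set.range f = simplexLambda v) {ht : ι → ℕ} (hht : ∀ r, ∑ i, f r i = ht r) :
    HasDeltaPoly (convexHull ℝ (Set.range v)) (∑ r, X ^ ht r) := by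
  have hzero : ehrhartCount (convexHull ℝ (Set.range v)) 0 = 1 := by
    have hne : (convexHull ℝ (Set.range v)).Nonempty := (Set.range_nonempty v).convexHull
    rw [ehrhartCount, Nat.cast_zero, Set.zero_smul_set hne, Set.inter_eq_self_of_subset_right]
    · exact Set.ncard_singleton _
    · rintro _ rfl
      exact mem_latticePts.2 fun i => zero_mem _
  have hseries : ehrhartSeries (convexHull ℝ (Set.range v)) =
      PowerSeries.mk 1 ^ (d + 1) * ((∑ r, X ^ ht r : Polynomial ℤ) : PowerSeries ℤ) := by
    ext n
    have hcoe : ((∑ r, X ^ ht r : Polynomial ℤ) : PowerSeries ℤ) =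
        ∑ r, (PowerSeries.X : PowerSeries ℤ) ^ ht r := by
      refine (map_sum (Polynomial.coeToPowerSeries.ringHom (R := ℤ))
        (fun r => (X : Polynomial ℤ) ^ ht r) Finset.univ).trans ?_
      exact Finset.sum_congr rfl fun r _ => by simp
    rw [hcoe, Finset.mul_sum, map_sum]
    simp only [PowerSeries.coeff_mul_X_pow', coeff_mk_one_pow_eq_card_finsuppAntidiag,
      ehrhartSeries, PowerSeries.coeff_mk]
    have hcount := ehrhartCount_eq_card hv hlat hinj hrange hht n
    rw [ite_eq_right_iff.2 (by rintro rfl; rw [hzero]; rfl), hcount]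
    push_cast
    rfl
  rw [HasDeltaPoly, hseries, ← mul_assoc, ← mul_pow, mul_comm (1 - _),
    PowerSeries.mk_one_mul_one_sub_eq_one, one_pow, one_mul]

lemma affineSpan_convexHull_range_eq_top {d : ℕ} {v : Fin (d + 1) → Fin d → ℝ}
    (hv : AffineIndependent ℝ v) : affineSpan ℝ (convexHull ℝ (Set.range v)) = ⊤ := by
  rw [affineSpan_convexHull, hv.affineSpan_eq_top_iff_card_eq_finrank_add_one]
  simp

lemma pyramidOver_height {e : ℕ} {Q : Set (Fin e → ℝ)} {p : Fin (e + 1) → ℝ}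
    (hp : p ∈ pyramidOver Q) : 0 ≤ p (Fin.last e) ∧ p (Fin.last e) ≤ 1 ∧
      (p (Fin.last e) = 1 → p = Fin.snoc (0 : Fin e → ℝ) (1 : ℝ)) := by
  let S : Set (Fin (e + 1) → ℝ) := {p | 0 ≤ p (Fin.last e) ∧ p (Fin.last e) ≤ 1 ∧
    (p (Fin.last e) = 1 → p = Fin.snoc (0 : Fin e → ℝ) (1 : ℝ))}
  have hS : Convex ℝ S := by
    refine convex_iff_forall_pos.2 fun x hx y hy a b ha hb hab => ?_
    obtain ⟨hx0, hx1, hx⟩ := hx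
    obtain ⟨hy0, hy1, hy⟩ := hy
    have hval : (a • x + b • y) (Fin.last e) = a * x (Fin.last e) + b * y (Fin.last e) := rfl
    refine ⟨?_, ?_, fun h => ?_⟩
    · rw [hval]; positivity
    · rw [hval]; nlinarith
    · rw [hval] at h
      have hx' := hx (by nlinarith)
      have hy' := hy (by nlinarith)
      rw [hx', hy', ← add_smul, hab, one_smul]
  refine convexHull_min (t := S) ?_ hS hp
  rintro _ (⟨x, _, rfl⟩ | rfl)
  · simp [S]
  · simp [S]

/-- If a full-dimensional lattice simplex is a lattice pyramid, then some coordinate vanishes on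
all of `Λ_Δ`. -/
theorem exists_forall_simplexLambda_eq_zero {d : ℕ} {v : Fin (d + 1) → Fin d → ℝ}
    (hv : AffineIndependent ℝ v) (hlat : ∀ i, v i ∈ latticePts d)
    (hP : IsLatticePyramid (convexHull ℝ (Set.range v))) :
    ∃ i, ∀ c ∈ simplexLambda v, c i = 0 := by
  obtain ⟨e, Q, -, -, f, hbij, himage⟩ := hP
  rw [affineSpan_convexHull_range_eq_top hv] at hbij
  have hvert : ∀ i, f (v i) ∈ pyramidOver Q := fun i =>
    himage ▸ ⟨v i, subset_convexHull ℝ _ ⟨i, rfl⟩, rfl⟩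
  have hint : ∀ x ∈ latticePts d, f x (Fin.last e) ∈ integerSubring := fun x hx =>
    mem_latticePts.1 (hbij.mapsTo ⟨hx, trivial⟩).1 _
  have hcomb : ∀ c : Fin (d + 1) → ℝ, ∑ i, c i = 1 →
      f (∑ i, c i • v i) = ∑ i, c i • f (v i) := fun c hc => by
    have := Finset.map_affineCombination Finset.univ v c hc f
    rwa [Finset.affineCombination_eq_linear_combination _ _ _ hc,
      Finset.affineCombination_eq_linear_combination _ _ _ hc] at this
  have hvals : ∀ i, f (v i) (Fin.last e) ≠ 1 → f (v i) (Fin.last e) = 0 := fun i h => by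
    obtain ⟨h0, h1, -⟩ := pyramidOver_height (hvert i)
    refine eq_of_sub_mem_integerSubring ⟨h0, lt_of_le_of_ne h1 h⟩ ⟨le_rfl, one_pos⟩ ?_
    rw [sub_zero]
    exact hint _ (hlat i)
  obtain ⟨i, hi⟩ : ∃ i, f (v i) (Fin.last e) = 1 := by
    by_contra! hne
    have hapex : (Fin.snoc (0 : Fin e → ℝ) (1 : ℝ) : Fin (e + 1) → ℝ) ∈ pyramidOver Q :=
      subset_convexHull ℝ _ (Or.inr rfl)
    rw [← himage] at hapex
    obtain ⟨x, hx, hfx⟩ := hapex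
    rw [← one_smul ℝ (convexHull ℝ (Set.range v)),
      mem_smul_convexHull_range v zero_le_one] at hx
    obtain ⟨c, -, hc1, rfl⟩ := hx
    have := congrFun hfx (Fin.last e)
    rw [hcomb c hc1] at this
    simp [fun j => hvals j (hne j)] at this
  have huniq : ∀ j, j ≠ i → f (v j) (Fin.last e) = 0 := fun j hj => hvals j fun h => by
    refine hj (hv.injective (hbij.injOn ⟨hlat j, trivial⟩ ⟨hlat i, trivial⟩ ?_))
    rw [(pyramidOver_height (hvert j)).2.2 h, (pyramidOver_height (hvert i)).2.2 hi]
  refine ⟨i, fun c hc => ?_⟩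
  obtain ⟨hc01, hcv, hcs⟩ := mem_simplexLambda.1 hc
  let c' : Fin (d + 1) → ℝ := fun j => c j + if j = i then 1 - ∑ k, c k else 0
  have hc' : ∑ j, c' j = 1 := by
    simp [c', Finset.sum_add_distrib]
  have hpt : ∑ j, c' j • v j = ∑ j, c j • v j + (1 - ∑ k, c k) • v i := by
    simp [c', add_smul, Finset.sum_add_distrib, ite_smul]
  have hlat' : ∑ j, c' j • v j ∈ latticePts d := by
    rw [hpt]
    exact mem_latticePts.2 fun j => add_mem (mem_latticePts.1 hcv j)
      (mul_mem (sub_mem (one_mem _) hcs) (mem_latticePts.1 (hlat i) j))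
  have hheight := hint _ hlat'
  rw [hcomb c' hc', Finset.sum_apply, Finset.sum_eq_single i
    (fun j _ hj => by simp [huniq j hj]) (by simp)] at hheight
  simp only [Pi.smul_apply, smul_eq_mul, hi, mul_one, c', if_true] at hheight
  refine eq_of_sub_mem_integerSubring (hc01 i) ⟨le_rfl, one_pos⟩ ?_
  have := sub_mem hheight (sub_mem (one_mem _) hcs)
  simpa using this

/-- The non-unit vertex of the simplex, with last coordinate `3` and the others equal to `2`
or `1`. -/
def apexVertex (k i1 i2 : ℕ) : Fin (k + 1) → ℝ :=
  Fin.snoc (fun j : Fin k => if (j : ℕ) + i1 + 2 ≤ 2 * i2 then (2 : ℝ) else 1) 3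

/-- The vertices of the simplex `Δ⁽³⁾ ⊆ ℝ^(k+1)`, ordered as `e₁, …, e_k, w, 0`. -/
def simplexVertex (k i1 i2 : ℕ) : Fin (k + 1 + 1) → Fin (k + 1) → ℝ :=
  Fin.snoc (Fin.snoc (fun j : Fin k => stdE (k + 1) j.castSucc) (apexVertex k i1 i2)) 0

lemma deltaThreeSimplex_eq (k i1 i2 : ℕ) :
    deltaThreeSimplex (k + 1) i1 i2 = convexHull ℝ (Set.range (simplexVertex k i1 i2)) := by
  have hapex : (fun j : Fin (k + 1) => if (j : ℕ) = k + 1 - 1 then (3 : ℝ)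
      else if (j : ℕ) + i1 + 2 ≤ 2 * i2 then 2 else 1) = apexVertex k i1 i2 := by
    funext j
    refine Fin.lastCases ?_ (fun j => ?_) j
    · simp [apexVertex]
    · simp [apexVertex, j.isLt.ne]
  have hstd : {x | ∃ j : Fin (k + 1), (j : ℕ) < k + 1 - 1 ∧ x = stdE (k + 1) j} =
      Set.range fun j : Fin k => stdE (k + 1) j.castSucc := by
    ext x
    constructor
    · rintro ⟨j, hj, rfl⟩
      exact ⟨⟨j, hj⟩, rfl⟩
    · rintro ⟨j, rfl⟩
      exact ⟨j.castSucc, by simp, rfl⟩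
  rw [deltaThreeSimplex, hapex, hstd, simplexVertex, Fin.range_snoc, Fin.range_snoc,
    Set.insert_union, Set.singleton_union]

lemma sum_smul_simplexVertex (k i1 i2 : ℕ) (c : Fin (k + 1 + 1) → ℝ) :
    ∑ i, c i • simplexVertex k i1 i2 i =
      Fin.snoc (fun j : Fin k => c j.castSucc.castSucc +
        c (Fin.last k).castSucc * if (j : ℕ) + i1 + 2 ≤ 2 * i2 then (2 : ℝ) else 1)
        (c (Fin.last k).castSucc * 3) := by
  funext j
  rw [Finset.sum_apply]
  simp only [Fin.sum_univ_castSucc, simplexVertex, Fin.snoc_castSucc, Fin.snoc_last,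
    Pi.smul_apply, smul_eq_mul, Pi.zero_apply, mul_zero, add_zero]
  refine Fin.lastCases ?_ (fun j => ?_) j
  · simp [stdE, apexVertex, (Fin.castSucc_lt_last _).ne']
  · simp [stdE, apexVertex]

lemma simplexVertex_mem_latticePts (k i1 i2 : ℕ) (i : Fin (k + 1 + 1)) :
    simplexVertex k i1 i2 i ∈ latticePts (k + 1) := by
  have h2 : (2 : ℝ) ∈ integerSubring := by exact_mod_cast natCast_mem_integerSubring 2
  refine mem_latticePts.2 fun j => ?_
  refine Fin.lastCases ?_ (fun i => Fin.lastCases ?_ (fun i => ?_) i) i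
  · simp [simplexVertex, zero_mem]
  · simp only [simplexVertex, Fin.snoc_castSucc, Fin.snoc_last]
    refine Fin.lastCases ?_ (fun j => ?_) j
    · simp [apexVertex]
    · simp only [apexVertex, Fin.snoc_castSucc]
      split_ifs
      · exact h2
      · exact one_mem _
  · simp only [simplexVertex, Fin.snoc_castSucc, stdE]
    split_ifs
    · exact one_mem _
    · exact zero_mem _

lemma affineIndependent_simplexVertex (k i1 i2 : ℕ) :
    AffineIndependent ℝ (simplexVertex k i1 i2) := by
  rw [affineIndependent_iff_of_fintype]
  intro c hc hv
  rw [Finset.weightedVSub_eq_linear_combination _ hc, sum_smul_simplexVertex] at hv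
  have hw : c (Fin.last k).castSucc = 0 := by
    simpa using congrFun hv (Fin.last k)
  have hj : ∀ j : Fin k, c j.castSucc.castSucc = 0 := fun j => by
    simpa [hw] using congrFun hv j.castSucc
  have h0 : c (Fin.last (k + 1)) = 0 := by
    simpa [Fin.sum_univ_castSucc, hw, hj] using hc
  exact fun i => Fin.lastCases h0 (fun i => Fin.lastCases hw hj i) i

/-- The element of `Λ_Δ` whose coordinate at the vertex `w` is `1/3`. -/
def lambdaGenerator (k i1 i2 : ℕ) : Fin (k + 1 + 1) → ℝ :=
  Fin.snoc (Fin.snoc (fun j : Fin k => if (j : ℕ) + i1 + 2 ≤ 2 * i2 then (1 / 3 : ℝ) else 2 / 3)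
    (1 / 3)) (if i2 = 2 * i1 then 1 / 3 else 2 / 3)

lemma lambdaGenerator_pos_lt_one (k i1 i2 : ℕ) (i : Fin (k + 1 + 1)) :
    0 < lambdaGenerator k i1 i2 i ∧ lambdaGenerator k i1 i2 i < 1 := by
  refine Fin.lastCases ?_ (fun i => Fin.lastCases ?_ (fun i => ?_) i) i <;>
    simp only [lambdaGenerator, Fin.snoc_castSucc, Fin.snoc_last] <;> (try split_ifs) <;> norm_num

lemma sum_lambdaGenerator {k i1 i2 : ℕ} (hk : k + 2 = i1 + i2) (h12 : i1 ≤ i2)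
    (h2 : i2 ≤ 2 * i1) : ∑ i, lambdaGenerator k i1 i2 i = i1 := by
  have hsum : ∀ n m : ℕ, n ≤ m → ∑ j ∈ Finset.range m,
      (if j < n then (1 / 3 : ℝ) else 2 / 3) = (2 * m - n) / 3 := by
    intro n m h
    rw [Finset.sum_ite, Finset.sum_const, Finset.sum_const]
    have h1 : (Finset.range m).filter (· < n) = Finset.range n := by
      ext j; simp; omega
    have h2 : (Finset.range m).filter (fun j => ¬ j < n) = Finset.Ico n m := by
      ext j; simp; omega
    rw [h1, h2, Finset.card_range, Nat.card_Ico, nsmul_eq_mul, nsmul_eq_mul, Nat.cast_sub h]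
    ring
  have hk' : (k : ℝ) + 2 = i1 + i2 := by exact_mod_cast hk
  simp only [Fin.sum_univ_castSucc, lambdaGenerator, Fin.snoc_castSucc, Fin.snoc_last]
  rw [Fin.sum_univ_eq_sum_range fun j => if j + i1 + 2 ≤ 2 * i2 then (1 / 3 : ℝ) else 2 / 3]
  split_ifs with h
  · rw [Finset.sum_congr rfl fun j hj => if_congr (Q := j < k)
      (by have := Finset.mem_range.1 hj; omega) rfl rfl, hsum k k le_rfl]
    rw [h] at hk'
    push_cast at hk'
    linarith
  · rw [Finset.sum_congr rfl fun j hj => if_congr (Q := j < 2 * i2 - (i1 + 1))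
      (by omega) rfl rfl, hsum _ k (by omega), Nat.cast_sub (by omega)]
    push_cast
    linarith

lemma zero_mem_simplexLambda {d : ℕ} (v : Fin (d + 1) → Fin d → ℝ) : 0 ∈ simplexLambda v :=
  mem_simplexLambda.2 ⟨fun _ => ⟨le_rfl, one_pos⟩,
    by simp [mem_latticePts, zero_mem], by simp [zero_mem]⟩

lemma one_sub_mem_simplexLambda {d : ℕ} {v : Fin (d + 1) → Fin d → ℝ}
    (hlat : ∀ i, v i ∈ latticePts d) {c : Fin (d + 1) → ℝ} (hc : c ∈ simplexLambda v)
    (hpos : ∀ i, 0 < c i) : 1 - c ∈ simplexLambda v := by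
  obtain ⟨h01, hv, hs⟩ := mem_simplexLambda.1 hc
  refine mem_simplexLambda.2 ⟨fun i => ⟨?_, ?_⟩, ?_, ?_⟩
  · simpa using (h01 i).2.le
  · simpa using hpos i
  · have h1 := sum_smul_mem_latticePts hlat fun _ => one_mem integerSubring
    simp only [Pi.sub_apply, Pi.one_apply, sub_smul, Finset.sum_sub_distrib]
    exact mem_latticePts.2 fun j => sub_mem (mem_latticePts.1 h1 j) (mem_latticePts.1 hv j)
  · simp only [Pi.sub_apply, Pi.one_apply, Finset.sum_sub_distrib]
    exact sub_mem (sum_mem fun _ _ => one_mem _) hs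

lemma lambdaGenerator_mem_simplexLambda {k i1 i2 : ℕ} (hk : k + 2 = i1 + i2) (h12 : i1 ≤ i2)
    (h2 : i2 ≤ 2 * i1) : lambdaGenerator k i1 i2 ∈ simplexLambda (simplexVertex k i1 i2) := by
  refine mem_simplexLambda.2 ⟨fun i => ⟨(lambdaGenerator_pos_lt_one k i1 i2 i).1.le,
    (lambdaGenerator_pos_lt_one k i1 i2 i).2⟩, ?_, ?_⟩
  · rw [sum_smul_simplexVertex]
    refine mem_latticePts.2 fun j => ?_
    refine Fin.lastCases ?_ (fun j => ?_) j
    · simp [lambdaGenerator, one_mem]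
    · simp only [lambdaGenerator, Fin.snoc_castSucc, Fin.snoc_last]
      split_ifs <;> norm_num [one_mem]
  · rw [sum_lambdaGenerator hk h12 h2]
    exact natCast_mem_integerSubring _

lemma eq_of_mem_simplexLambda {k i1 i2 : ℕ} {a b : Fin (k + 1 + 1) → ℝ}
    (ha : a ∈ simplexLambda (simplexVertex k i1 i2))
    (hb : b ∈ simplexLambda (simplexVertex k i1 i2))
    (hab : a (Fin.last k).castSucc = b (Fin.last k).castSucc) : a = b := by
  obtain ⟨ha01, hav, has⟩ := mem_simplexLambda.1 ha
  obtain ⟨hb01, hbv, hbs⟩ := mem_simplexLambda.1 hb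
  rw [sum_smul_simplexVertex] at hav hbv
  have hj : ∀ j : Fin k, a j.castSucc.castSucc = b j.castSucc.castSucc := fun j => by
    refine eq_of_sub_mem_integerSubring (ha01 _) (hb01 _) ?_
    have := sub_mem (mem_latticePts.1 hav j.castSucc) (mem_latticePts.1 hbv j.castSucc)
    simpa only [Fin.snoc_castSucc, hab, add_sub_add_right_eq_sub] using this
  have h0 : a (Fin.last (k + 1)) = b (Fin.last (k + 1)) := by
    refine eq_of_sub_mem_integerSubring (ha01 _) (hb01 _) ?_
    have := sub_mem has hbs
    simpa only [Fin.sum_univ_castSucc, hj, hab, add_sub_add_left_eq_sub] using this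
  exact funext fun i => Fin.lastCases h0 (fun i => Fin.lastCases hab hj i) i

lemma range_eq_simplexLambda {k i1 i2 : ℕ} (hk : k + 2 = i1 + i2) (h12 : i1 ≤ i2)
    (h2 : i2 ≤ 2 * i1) :
    Set.range ![0, lambdaGenerator k i1 i2, 1 - lambdaGenerator k i1 i2] =
      simplexLambda (simplexVertex k i1 i2) := by
  have hgen := lambdaGenerator_mem_simplexLambda hk h12 h2
  have hsub := one_sub_mem_simplexLambda (simplexVertex_mem_latticePts k i1 i2) hgen
    fun i => (lambdaGenerator_pos_lt_one k i1 i2 i).1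
  have hval : lambdaGenerator k i1 i2 (Fin.last k).castSucc = 1 / 3 := by simp [lambdaGenerator]
  refine Set.Subset.antisymm ?_ fun c hc => ?_
  · rintro _ ⟨r, rfl⟩
    fin_cases r
    · exact zero_mem_simplexLambda _
    · exact hgen
    · exact hsub
  · obtain ⟨hc01, hcv, -⟩ := mem_simplexLambda.1 hc
    rw [sum_smul_simplexVertex] at hcv
    obtain ⟨z, hz⟩ := mem_integerSubring.1 (mem_latticePts.1 hcv (Fin.last k))
    rw [Fin.snoc_last] at hz
    obtain ⟨h0, h1⟩ := hc01 (Fin.last k).castSucc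
    have hz0 : 0 ≤ z := by
      have : (0 : ℝ) ≤ z := by linarith
      exact_mod_cast this
    have hz3 : z < 3 := by
      have : (z : ℝ) < 3 := by linarith
      exact_mod_cast this
    interval_cases z
    · refine ⟨0, (eq_of_mem_simplexLambda hc (zero_mem_simplexLambda _) ?_).symm⟩
      norm_num at hz
      simpa using hz
    · refine ⟨1, (eq_of_mem_simplexLambda hc hgen ?_).symm⟩
      rw [hval]
      norm_num at hz
      linarith
    · refine ⟨2, (eq_of_mem_simplexLambda hc hsub ?_).symm⟩
      rw [Pi.sub_apply, hval, Pi.one_apply]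
      norm_num at hz
      linarith

lemma injective_lambdaElements (k i1 i2 : ℕ) : Function.Injective
    ![0, lambdaGenerator k i1 i2, 1 - lambdaGenerator k i1 i2] := by
  have hval : lambdaGenerator k i1 i2 (Fin.last k).castSucc = 1 / 3 := by simp [lambdaGenerator]
  intro r s h
  have := congrFun h (Fin.last k).castSucc
  fin_cases r <;> fin_cases s <;> first | rfl | (exfalso; norm_num [hval] at this)

/-- `Δ⁽³⁾` is a non-pyramid lattice simplex of dimension `d = i₁ + i₂ − 1`
with δ-polynomial `1 + t^{i₁} + t^{i₂}`. -/
theorem deltaThreeSimplex_properties (i1 i2 : ℕ) (hi1 : 1 ≤ i1) (h12 : i1 ≤ i2)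
    (h2 : i2 ≤ 2 * i1) (d : ℕ) (hd : d = i1 + i2 - 1) :
    IsLatticeSimplexFD (deltaThreeSimplex d i1 i2) ∧
    affineSpan ℝ (deltaThreeSimplex d i1 i2) = ⊤ ∧
    HasDeltaPoly (deltaThreeSimplex d i1 i2) (1 + X ^ i1 + X ^ i2) ∧
    ((1 + X ^ i1 + X ^ i2 : Polynomial ℤ).eval 1 = 3) ∧
    ¬ IsLatticePyramid (deltaThreeSimplex d i1 i2) := by
  obtain ⟨k, rfl⟩ : ∃ k, d = k + 1 := ⟨d - 1, by omega⟩
  have hk : k + 2 = i1 + i2 := by omega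
  have hv := affineIndependent_simplexVertex k i1 i2
  have hlat := simplexVertex_mem_latticePts k i1 i2
  have hheight : ∀ r, ∑ i, ![0, lambdaGenerator k i1 i2, 1 - lambdaGenerator k i1 i2] r i =
      ((![0, i1, i2] r : ℕ) : ℝ) := by
    have hsum := sum_lambdaGenerator hk h12 h2
    have hk' : (k : ℝ) + 2 = i1 + i2 := by exact_mod_cast hk
    intro r
    fin_cases r
    · simp
    · simpa using hsum
    · simp [Finset.sum_sub_distrib, hsum]
      linarith
  rw [deltaThreeSimplex_eq]
  refine ⟨⟨_, hv, hlat, rfl⟩, affineSpan_convexHull_range_eq_top hv, ?_, by norm_num, fun hP => ?_⟩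
  · have := hasDeltaPoly_convexHull_range hv hlat (injective_lambdaElements k i1 i2)
      (range_eq_simplexLambda hk h12 h2) hheight
    simpa [Fin.sum_univ_three] using this
  · obtain ⟨i, hi⟩ := exists_forall_simplexLambda_eq_zero hv hlat hP
    exact (lambdaGenerator_pos_lt_one k i1 i2 i).1.ne'
      (hi _ (lambdaGenerator_mem_simplexLambda hk h12 h2))
end
end
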